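/- arXiv:2308.07256 — 3 statements merged into one kernel-verified Lean document; each statement's English description precedes it below -/
import Mathlib

section
/- Let n, d, r be positive integers with rd ≤ n. For every ordered set partition π ∈ OP(n,d,r), the r-jellyfish invariant [π]_r lies in the flamingo Specht module S^{(d^r, 1^{n−rd})}, i.e., [π]_r belongs to the ℂ-span of the products ∏_{i=1}^d p_{J_i} over all tuples (J_1,…,J_d) of pairwise disjoint subsets of [n] with union [n], |J_1| = ν, and |J_i| = r for 2 ≤ i ≤ d. -/
open scoped Classical

namespace Jellyfish

/-- A tableau with `ν` rows and `d` columns, whose cells are either empty or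
contain an element of `Fin n`. -/
abbrev Tab (ν n d : ℕ) := Fin ν → Fin d → Option (Fin n)

/-- `π` is an ordered set partition of `[n]` into `d` blocks, each of size at least `r`:
blocks are pairwise disjoint with union `[n]` and cardinality at least `r`. -/
def IsOSP (n d r : ℕ) (π : Fin d → Finset (Fin n)) : Prop :=
  (∀ j, r ≤ (π j).card) ∧
  (∀ j k, j ≠ k → Disjoint (π j) (π k)) ∧
  (Finset.univ.biUnion π = Finset.univ)

/-- The nonempty entries of column `j` of `T`, read from top to bottom. -/
def colList {ν n d : ℕ} (T : Tab ν n d) (j : Fin d) : List (Fin n) :=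
  (List.finRange ν).filterMap (fun i => T i j)

/-- `T` is an `r`-jellyfish tableau for `π`: it has `n - (d-1)r` rows and `d` columns,
every cell in the first `r` rows is nonempty, every lower row has exactly one nonempty
cell, and the nonempty entries of column `j`, top to bottom, are exactly the elements
of `π j` in increasing order. -/
def IsJelly (n d r : ℕ) (π : Fin d → Finset (Fin n)) (T : Tab (n - (d-1)*r) n d) : Prop :=
  (∀ i : Fin (n - (d-1)*r), (i : ℕ) < r → ∀ j, (T i j).isSome) ∧
  (∀ i : Fin (n - (d-1)*r), r ≤ (i : ℕ) → ∃! j, (T i j).isSome) ∧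
  (∀ j, colList T j = (π j).sort (· ≤ ·))

/-- The row reading word of `T` (rows top to bottom, each row left to right), with
each entry tagged by its column index. -/
def cells {ν n d : ℕ} (T : Tab ν n d) : List (Fin d × Fin n) :=
  (List.finRange ν).flatMap (fun i =>
    (List.finRange d).filterMap (fun j => (T i j).map (fun v => (j, v))))

/-- The number of inversions of a (column-tagged) word: pairs of positions `p < q`
whose values are inverted. -/
def invList {n d : ℕ} : List (Fin d × Fin n) → ℕ
  | [] => 0
  | a :: l => l.countP (fun b => decide (b.2 < a.2)) + invList l

/-- The number of inversions of a (column-tagged) word that do not involve two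
entries lying in the same column. -/
def invList' {n d : ℕ} : List (Fin d × Fin n) → ℕ
  | [] => 0
  | a :: l => l.countP (fun b => decide (b.2 < a.2 ∧ b.1 ≠ a.1)) + invList' l

/-- The sign `(-1)^(inv T)` of a tableau, where `inv T` counts all inversions of the
row reading word. -/
def tabSign {ν n d : ℕ} (T : Tab ν n d) : ℤ := (-1) ^ invList (cells T)

/-- The sign `(-1)^(inv T)` of a (column-permuted) tableau, where inversions within a
single column are not counted. -/
def tabSign' {ν n d : ℕ} (T : Tab ν n d) : ℤ := (-1) ^ invList' (cells T)

/-- The minor `M_I^J` of the `ν × n` matrix of indeterminates `x_{ij}`: the determinant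
of the submatrix with rows `I` and columns `J`, each taken in increasing order
(and `0` if `|I| ≠ |J|`). -/
noncomputable def minor (ν n : ℕ) (I : Finset (Fin ν)) (J : Finset (Fin n)) :
    MvPolynomial (Fin ν × Fin n) ℂ :=
  if h : I.card = J.card then
    Matrix.det (Matrix.of fun a b : Fin I.card =>
      MvPolynomial.X (I.orderEmbOfFin rfl a, J.orderEmbOfFin h.symm b))
  else 0

/-- The set `R_j(T)` of rows of `T` containing an entry of block `j`. -/
def rowsUsed {ν n d : ℕ} (T : Tab ν n d) (j : Fin d) : Finset (Fin ν) :=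
  Finset.univ.filter (fun i => (T i j).isSome)

/-- The product of minors `J(T) = ∏_j M_{R_j(T)}^{π_j}`. -/
noncomputable def JProd {ν n d : ℕ} (π : Fin d → Finset (Fin n)) (T : Tab ν n d) :
    MvPolynomial (Fin ν × Fin n) ℂ :=
  ∏ j : Fin d, minor ν n (rowsUsed T j) (π j)

/-- The `r`-jellyfish invariant `[π]_r = Σ_{T ∈ J_r(π)} sgn(T)·J(T)`. -/
noncomputable def jellyInv (n d r : ℕ) (π : Fin d → Finset (Fin n)) :
    MvPolynomial (Fin (n - (d-1)*r) × Fin n) ℂ :=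
  ∑ T : Tab (n - (d-1)*r) n d,
    if IsJelly n d r π T then (tabSign T : ℂ) • JProd π T else 0


/-- Permute the columns of `T` according to `σ`: column `j` of the result is
column `σ⁻¹ j` of `T`. -/
def colPerm {ν n d : ℕ} (σ : Equiv.Perm (Fin d)) (T : Tab ν n d) : Tab ν n d :=
  fun i j => T i (σ⁻¹ j)

/-- The top `k` rows of a tableau with `ν` rows. -/
def topRows (ν k : ℕ) : Finset (Fin ν) := Finset.univ.filter (fun i => (i : ℕ) < k)

/-- The top-justified minor `p_J`, using rows `1, …, |J|` and the columns in `J`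
(in increasing order). -/
noncomputable def topMinor (ν n : ℕ) (J : Finset (Fin n)) :
    MvPolynomial (Fin ν × Fin n) ℂ :=
  minor ν n (topRows ν J.card) J

/-- The spanning set of the flamingo Specht module `S^{(d^r, 1^{n-rd})}`: all products
`∏_i p_{J_i}` over tuples `(J_1, …, J_d)` of pairwise disjoint subsets of `[n]` with
union `[n]`, `|J_1| = n-(d-1)r` and `|J_i| = r` for `i ≥ 2`. -/
def flamingoSet (n d r : ℕ) : Set (MvPolynomial (Fin (n - (d-1)*r) × Fin n) ℂ) :=
  { f | ∃ Js : Fin d → Finset (Fin n),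
      (∀ i j, i ≠ j → Disjoint (Js i) (Js j)) ∧
      (Finset.univ.biUnion Js = Finset.univ) ∧
      (∀ i : Fin d, (i : ℕ) = 0 → (Js i).card = n - (d-1)*r) ∧
      (∀ i : Fin d, (i : ℕ) ≠ 0 → (Js i).card = r) ∧
      f = ∏ i : Fin d, topMinor (n - (d-1)*r) n (Js i) }

/-- `P` is an (unordered) set partition of `[n]`: a collection of pairwise disjoint
nonempty blocks whose union is `[n]`. -/
def IsUPartition (n : ℕ) (P : Finset (Finset (Fin n))) : Prop :=
  (∀ B ∈ P, B.Nonempty) ∧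
  (∀ B1 ∈ P, ∀ B2 ∈ P, B1 ≠ B2 → Disjoint B1 B2) ∧
  (∀ x : Fin n, ∃ B ∈ P, x ∈ B)

/-- `P` is noncrossing: there do not exist `a < b < c < e` with `a, c` in one block
and `b, e` in a different block. -/
def IsNoncrossing (n : ℕ) (P : Finset (Finset (Fin n))) : Prop :=
  ∀ a b c e : Fin n, a < b → b < c → c < e →
    ∀ B1 ∈ P, ∀ B2 ∈ P, a ∈ B1 → c ∈ B1 → b ∈ B2 → e ∈ B2 → B1 = B2

/-- `P` is a noncrossing set partition of `[n]` into `d` blocks, each of size at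
least `r` (the set `NC(n,d,r)`). -/
def IsNCPartition (n d r : ℕ) (P : Finset (Finset (Fin n))) : Prop :=
  IsUPartition n P ∧ IsNoncrossing n P ∧ P.card = d ∧ ∀ B ∈ P, r ≤ B.card

/-- The set of smallest elements of the blocks of an ordered set partition. -/
def blockMinima (n d : ℕ) (π : Fin d → Finset (Fin n)) : Finset (Fin n) :=
  Finset.univ.filter (fun x => ∃ j, x ∈ π j ∧ ∀ y ∈ π j, x ≤ y)

/-- The set of smallest elements (block minima) of an unordered set partition. -/
def blockMinimaU (n : ℕ) (P : Finset (Finset (Fin n))) : Finset (Fin n) :=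
  Finset.univ.filter (fun x => ∃ B ∈ P, x ∈ B ∧ ∀ y ∈ B, x ≤ y)

/-- The set of largest elements (block maxima) of an unordered set partition. -/
def blockMaximaU (n : ℕ) (P : Finset (Finset (Fin n))) : Finset (Fin n) :=
  Finset.univ.filter (fun x => ∃ B ∈ P, x ∈ B ∧ ∀ y ∈ B, y ≤ x)

section Determinants

variable {R m C : Type*} [CommRing R] [DecidableEq C]

/-- The matrix obtained from `B` by keeping only the entries whose row label agrees with
their column label. -/
def labelled (B : Matrix m m R) (f g : m → C) : Matrix m m R :=
  Matrix.of fun k j => if f k = g j then B k j else 0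

theorem labelled_transpose (B : Matrix m m R) (f g : m → C) :
    (labelled B f g).transpose = labelled B.transpose g f := by
  ext k j
  simp [labelled, eq_comm]

variable [Fintype m] [DecidableEq m]

/-- For fixed column labels, a determinant is the sum over all row labellings. -/
theorem det_eq_sum_rowLabels [Fintype C] (B : Matrix m m R) (g : m → C) :
    B.det = ∑ f : m → C, (labelled B f g).det := by
  have h := (Matrix.detRowAlternating (n := m) (R := R)).toMultilinearMap.map_sum
    (fun (k : m) (c : C) => (fun j => if c = g j then B k j else 0 : m → R))
  have hB : (fun k => ∑ c : C, (fun j => if c = g j then B k j else 0 : m → R)) = B := by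
    ext k j
    simp [Finset.sum_apply]
  rw [hB] at h
  exact h

/-- For fixed row labels, a determinant is the sum over all column labellings. -/
theorem det_eq_sum_colLabels [Fintype C] (B : Matrix m m R) (f : m → C) :
    B.det = ∑ g : m → C, (labelled B f g).det := by
  rw [← Matrix.det_transpose, det_eq_sum_rowLabels _ f]
  refine Finset.sum_congr rfl fun g _ => ?_
  rw [← labelled_transpose, Matrix.det_transpose]

theorem det_labelled_of_perm {C : Type*} [Fintype C] [LinearOrder C] (B : Matrix m m R) (f g : m → C)
    (w : Equiv.Perm m) (hw : ∀ k, f k = g (w k)) :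
    (labelled B f g).det = Equiv.Perm.sign w *
      ∏ c : C, (Matrix.of fun j j' : {j // g j = c} => B (w.symm j) j').det := by
  have h1 := Matrix.det_permute w.symm (labelled B f g)
  have h2 : ((labelled B f g).submatrix w.symm id).BlockTriangular g := by
    intro j j' hj
    simp [labelled, hw, hj.ne']
  rw [h2.det_fintype] at h1
  have h3 : ∀ c : C, (((labelled B f g).submatrix w.symm id).toSquareBlock g c) =
      (Matrix.of fun j j' : {j // g j = c} => B (w.symm j) j') := by
    intro c
    ext j j'
    simp [labelled, Matrix.toSquareBlock, Matrix.toSquareBlockProp, hw, j.2, j'.2]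
  simp_rw [h3] at h1
  rw [h1, ← mul_assoc, Equiv.Perm.sign_symm, ← Int.cast_mul, ← Units.val_mul, Int.units_mul_self]
  simp

theorem exists_perm_of_det_labelled_ne_zero (B : Matrix m m R) (f g : m → C)
    (h : (labelled B f g).det ≠ 0) : ∃ w : Equiv.Perm m, ∀ k, f k = g (w k) := by
  contrapose! h
  rw [← Matrix.det_transpose, Matrix.det_apply]
  refine Finset.sum_eq_zero fun w _ => ?_
  obtain ⟨k, hk⟩ := h w
  rw [Finset.prod_eq_zero (Finset.mem_univ k), smul_zero]
  simp [labelled, hk]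

end Determinants

section Minors

variable {ν n : ℕ} {ι : Type*} [Fintype ι]

theorem exists_equiv_comp_eq_orderEmbOfFin {α : Type*} [LinearOrder α] {q : ι → α}
    (hq : Function.Injective q) {k : ℕ} (hk : (Finset.univ.image q).card = k) :
    ∃ a : Fin k ≃ ι, ∀ i, q (a i) = (Finset.univ.image q).orderEmbOfFin hk i := by
  have hx : ∀ i, ∃ x, q x = (Finset.univ.image q).orderEmbOfFin hk i := fun i => by
    obtain ⟨x, -, hx⟩ := Finset.mem_image.1 (Finset.orderEmbOfFin_mem (Finset.univ.image q) hk i)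
    exact ⟨x, hx⟩
  choose a ha using hx
  have hinj : Function.Injective a := fun i j hij => by
    have := congrArg q hij
    rw [ha, ha] at this
    simpa using this
  have hcard : Fintype.card (Fin k) = Fintype.card ι := by
    rw [Fintype.card_fin, ← hk, Finset.card_image_of_injective _ hq, Finset.card_univ]
  exact ⟨Equiv.ofBijective a ((Fintype.bijective_iff_injective_and_card a).2 ⟨hinj, hcard⟩), ha⟩

variable [DecidableEq ι]

theorem minor_image_eq_of_monotone {h : ι → Fin ν} {q : ι → Fin n}
    (hq : Function.Injective q) (hmono : ∀ i j, q i < q j → h i < h j) :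
    minor ν n (Finset.univ.image h) (Finset.univ.image q) =
      (Matrix.of fun i j : ι => (MvPolynomial.X (h i, q j) :
        MvPolynomial (Fin ν × Fin n) ℂ)).det := by
  have hh : Function.Injective h := fun i j hij => by
    rcases lt_trichotomy (q i) (q j) with hlt | heq | hlt
    · exact absurd hij (hmono _ _ hlt).ne
    · exact hq heq
    · exact absurd hij (hmono _ _ hlt).ne'
  have hcard : (Finset.univ.image h).card = (Finset.univ.image q).card := by
    rw [Finset.card_image_of_injective _ hh, Finset.card_image_of_injective _ hq]
  obtain ⟨a, ha⟩ := exists_equiv_comp_eq_orderEmbOfFin hq hcard.symm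
  have hb : (fun i => h (a i)) = (Finset.univ.image h).orderEmbOfFin rfl :=
    Finset.orderEmbOfFin_unique rfl (fun i => by simp) fun i j hij =>
      hmono _ _ (by rw [ha, ha]; simpa using hij)
  rw [minor, dif_pos hcard, ← Matrix.det_submatrix_equiv_self a]
  congr 1
  ext1 i j
  simp only [Matrix.of_apply, Matrix.submatrix_apply]
  rw [ha, ← hb]

theorem det_X_eq_sign_mul_minor_image {h : ι → Fin ν} {q : ι → Fin n}
    (hh : Function.Injective h) (hq : Function.Injective q) :
    ∃ s : ℤˣ, (Matrix.of fun i j : ι => (MvPolynomial.X (h i, q j) :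
        MvPolynomial (Fin ν × Fin n) ℂ)).det =
      ((s : ℤ) : MvPolynomial (Fin ν × Fin n) ℂ) *
        minor ν n (Finset.univ.image h) (Finset.univ.image q) := by
  have hcard : (Finset.univ.image h).card = (Finset.univ.image q).card := by
    rw [Finset.card_image_of_injective _ hh, Finset.card_image_of_injective _ hq]
  obtain ⟨a, ha⟩ := exists_equiv_comp_eq_orderEmbOfFin hq hcard.symm
  obtain ⟨b, hb⟩ := exists_equiv_comp_eq_orderEmbOfFin hh rfl
  refine ⟨Equiv.Perm.sign (a.trans b.symm), ?_⟩
  rw [minor, dif_pos hcard, ← Matrix.det_permute, ← Matrix.det_submatrix_equiv_self a]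
  congr 1
  ext1 i j
  simp only [Matrix.of_apply, Matrix.submatrix_apply, id]
  rw [ha, ← hb]
  simp

end Minors

section Inversions

theorem countP_ofFn {α : Type*} {m : ℕ} (p : α → Bool) (h : Fin m → α) :
    (List.ofFn h).countP p = (Finset.univ.filter fun i => p (h i) = true).card := by
  rw [List.ofFn_eq_map, List.countP_map, List.countP_eq_length_filter,
    ← List.toFinset_card_of_nodup ((List.nodup_finRange m).filter _)]
  congr 1
  ext i
  simp

theorem neg_one_pow_invList_ofFn {n d : ℕ} : ∀ {m : ℕ} (h : Fin m → Fin d × Fin n),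
    (-1 : ℤ) ^ invList (List.ofFn h) =
      ∏ i, ∏ j ∈ Finset.Ioi i, if (h j).2 < (h i).2 then (-1 : ℤ) else 1
  | 0, h => by simp [invList]
  | m + 1, h => by
    rw [List.ofFn_succ, invList, pow_add, neg_one_pow_invList_ofFn, Fin.prod_univ_succ, countP_ofFn]
    congr 1
    · rw [Fin.prod_Ioi_zero, Finset.prod_ite]
      simp
    · refine Finset.prod_congr rfl fun i _ => ?_
      rw [Fin.prod_Ioi_succ]

theorem neg_one_pow_invList_eq_sign {n d : ℕ} (t : Fin n → Fin d) (w : Equiv.Perm (Fin n)) :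
    (-1 : ℤ) ^ invList (List.ofFn fun k => (t k, w k)) = Equiv.Perm.sign w := by
  rw [neg_one_pow_invList_ofFn, Equiv.Perm.sign_eq_prod_prod_Ioi]
  push_cast
  refine Finset.prod_congr rfl fun i _ => Finset.prod_congr rfl fun j hj => ?_
  have hne : w i ≠ w j := w.injective.ne (Finset.mem_Ioi.1 hj).ne
  by_cases h : w i < w j
  · simp [h, h.le]
  · simp [h, lt_of_le_of_ne (not_lt.1 h) hne.symm]

end Inversions

section Slots

variable {ν n d r : ℕ}

theorem filterMap_eq_singleton {α β : Type*} {g : α → Option β} {a : α} {b : β} (hg : g a = some b) :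
    ∀ {l : List α}, l.Nodup → a ∈ l → (∀ x, x ≠ a → g x = none) → l.filterMap g = [b]
  | [], _, ha, _ => by simp at ha
  | x :: l, hl, ha, hn => by
    rw [List.nodup_cons] at hl
    by_cases hx : x = a
    · subst hx
      rw [List.filterMap_cons_some hg]
      congr 1
      rw [List.filterMap_eq_nil_iff]
      exact fun y hy => hn y fun h => hl.1 (h ▸ hy)
    · rw [List.filterMap_cons_none (hn x hx)]
      exact filterMap_eq_singleton hg hl.2 (by simpa [Ne.symm hx] using ha) hn

/-- The slots of a jellyfish tableau in reading order: all cells of the first `r` rows, and a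
single slot, recorded in column `0`, for each lower row. -/
def slotList (ν d r : ℕ) : List (Fin ν × Fin d) :=
  (List.finRange ν).flatMap fun i : Fin ν =>
    (List.finRange d).filterMap fun c : Fin d =>
      if (i : ℕ) < r ∨ (c : ℕ) = 0 then some (i, c) else none

theorem mem_slotList {p : Fin ν × Fin d} :
    p ∈ slotList ν d r ↔ (p.1 : ℕ) < r ∨ (p.2 : ℕ) = 0 := by
  obtain ⟨i, c⟩ := p
  simp only [slotList, List.mem_flatMap, List.mem_filterMap, List.mem_finRange, true_and,
    Option.ite_none_right_eq_some, Option.some.injEq, Prod.mk.injEq]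
  constructor
  · rintro ⟨i, c, h, rfl, rfl⟩
    exact h
  · exact fun h => ⟨i, c, h, rfl, rfl⟩

theorem nodup_slotList : (slotList ν d r).Nodup := by
  rw [slotList, List.nodup_flatMap]
  refine ⟨fun i _ => ?_, ?_⟩
  · refine (List.nodup_finRange d).filterMap fun c c' b hb hb' => ?_
    simp only [Option.mem_def, Option.ite_none_right_eq_some, Option.some.injEq] at hb hb'
    exact congrArg Prod.snd (hb.2.trans hb'.2.symm)
  · refine (List.nodup_finRange ν).imp fun {i i'} hne => ?_
    intro p hp hp'
    simp only [List.mem_filterMap, Option.ite_none_right_eq_some, Option.some.injEq] at hp hp'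
    obtain ⟨c, -, -, rfl⟩ := hp
    obtain ⟨c', -, -, h⟩ := hp'
    exact hne (congrArg Prod.fst h).symm

theorem card_filter_val_lt (h : r ≤ ν) :
    (Finset.univ.filter fun i : Fin ν => (i : ℕ) < r).card = r := by
  rw [Fin.card_filter_val_lt, min_eq_right h]

theorem length_slotList (hd : 0 < d) (h : r ≤ ν) :
    (slotList ν d r).length = ν + (d - 1) * r := by
  have hrow : ∀ i : Fin ν, ((List.finRange d).filterMap fun c : Fin d =>
      if (i : ℕ) < r ∨ (c : ℕ) = 0 then some (i, c) else none).length =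
      1 + if (i : ℕ) < r then d - 1 else 0 := by
    intro i
    by_cases hi : (i : ℕ) < r
    · simp only [hi, true_or, if_true, List.filterMap_eq_map', List.length_map,
        List.length_finRange]
      omega
    · rw [filterMap_eq_singleton (a := ⟨0, hd⟩) (b := (i, ⟨0, hd⟩)) (by simp)
        (List.nodup_finRange d) (List.mem_finRange _)]
      · simp [hi]
      · intro c hc
        have : (c : ℕ) ≠ 0 := fun h0 => hc (Fin.ext h0)
        simp [hi, this]
  rw [slotList, List.length_flatMap]
  simp_rw [hrow]
  rw [← List.ofFn_eq_map, List.sum_ofFn, Finset.sum_add_distrib, ← Finset.sum_filter,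
    Finset.sum_const, Finset.sum_const, card_filter_val_lt h]
  simp [mul_comm]

/-- `s` enumerates the slots in reading order. -/
structure IsSlotEnum (r : ℕ) (s : Fin n → Fin ν × Fin d) : Prop where
  injective : Function.Injective s
  exists_iff : ∀ p, (∃ k, s k = p) ↔ (p.1 : ℕ) < r ∨ (p.2 : ℕ) = 0
  ofFn_eq : List.ofFn s = slotList ν d r

theorem exists_isSlotEnum (hd : 0 < d) (h : r ≤ ν) (hn : ν + (d - 1) * r = n) :
    ∃ s : Fin n → Fin ν × Fin d, IsSlotEnum r s := by
  have hl : (slotList ν d r).length = n := (length_slotList hd h).trans hn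
  subst hl
  refine ⟨(slotList ν d r).get, List.nodup_iff_injective_get.1 nodup_slotList, fun p => ?_,
    List.ofFn_get _⟩
  rw [← mem_slotList, List.mem_iff_get]

namespace IsSlotEnum

variable {s : Fin n → Fin ν × Fin d}

theorem snd_eq_zero (hs : IsSlotEnum r s) {k : Fin n} (h : ¬ ((s k).1 : ℕ) < r) : ((s k).2 : ℕ) = 0 :=
  ((hs.exists_iff (s k)).1 ⟨k, rfl⟩).resolve_left h

theorem eq_of_fst_eq (hs : IsSlotEnum r s) {k k' : Fin n} (h : (s k).1 = (s k').1)
    (h' : ((s k).1 : ℕ) < r → (s k).2 = (s k').2) : k = k' := by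
  refine hs.injective (Prod.ext h ?_)
  by_cases hr : ((s k).1 : ℕ) < r
  · exact h' hr
  · exact Fin.ext ((hs.snd_eq_zero hr).trans (hs.snd_eq_zero (h ▸ hr)).symm)

end IsSlotEnum

end Slots

section Placements

variable {ν n d r : ℕ}

theorem colList_eq_sort_iff (T : Tab ν n d) (c : Fin d) (P : Finset (Fin n)) :
    colList T c = P.sort (· ≤ ·) ↔ (∀ v, v ∈ P ↔ ∃ i, T i c = some v) ∧
      ∀ i i' v v', i < i' → T i c = some v → T i' c = some v' → v < v' := by
  have hmem : ∀ v, v ∈ colList T c ↔ ∃ i, T i c = some v := fun v => by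
    simp [colList]
  have hpw : (colList T c).Pairwise (· < ·) ↔
      ∀ i i' v v', i < i' → T i c = some v → T i' c = some v' → v < v' := by
    rw [colList, List.pairwise_filterMap, ← List.ofFn_id, List.pairwise_ofFn]
    exact ⟨fun h i i' v v' hi hv hv' => h hi v hv v' hv',
      fun h i i' hi v hv v' hv' => h i i' v v' hi hv hv'⟩
  rw [← hpw]
  constructor
  · intro h
    refine ⟨fun v => ?_, ?_⟩
    · rw [← hmem, h, Finset.mem_sort]
    · rw [h]
      exact (Finset.sortedLT_sort P).pairwise
  · rintro ⟨h1, h2⟩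
    refine List.Perm.eq_of_pairwise (le := (· < ·)) (fun a b _ _ hab hba => absurd hab hba.asymm) h2
      (Finset.sortedLT_sort P).pairwise ?_
    rw [List.perm_ext_iff_of_nodup (h2.imp fun h => h.ne) (Finset.sort_nodup _ _)]
    intro v
    rw [hmem, Finset.mem_sort, h1]

/-- The three conditions of `IsJelly`, for an arbitrary number of rows, with the blocks given as
the fibres of `blk`. -/
def IsFilling (r : ℕ) (blk : Fin n → Fin d) (T : Tab ν n d) : Prop :=
  (∀ i : Fin ν, (i : ℕ) < r → ∀ c, (T i c).isSome) ∧
  (∀ i : Fin ν, r ≤ (i : ℕ) → ∃! c, (T i c).isSome) ∧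
  (∀ c, colList T c = (Finset.univ.filter fun v => blk v = c).sort (· ≤ ·))

/-- `e` places each value into a slot so that upper slots receive values of the block of their
column, and values of a common block are placed increasingly from top to bottom. -/
structure IsPlacement (r : ℕ) (blk : Fin n → Fin d) (s : Fin n → Fin ν × Fin d)
    (e : Equiv.Perm (Fin n)) : Prop where
  snd_eq : ∀ v, ((s (e v)).1 : ℕ) < r → (s (e v)).2 = blk v
  fst_lt : ∀ v v', v < v' → blk v = blk v' → (s (e v)).1 < (s (e v')).1

/-- The tableau attached to a placement. -/
noncomputable def tabOf (blk : Fin n → Fin d) (s : Fin n → Fin ν × Fin d)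
    (e : Equiv.Perm (Fin n)) : Tab ν n d := fun i c =>
  if h : ∃ v, blk v = c ∧ (s (e v)).1 = i then some h.choose else none

namespace IsPlacement

variable {blk : Fin n → Fin d} {s : Fin n → Fin ν × Fin d} {e : Equiv.Perm (Fin n)}

theorem eq_of_fst_eq (he : IsPlacement r blk s e) {v v' : Fin n} (hb : blk v = blk v')
    (h : (s (e v)).1 = (s (e v')).1) : v = v' := by
  rcases lt_trichotomy v v' with hlt | heq | hlt
  · exact absurd h (he.fst_lt _ _ hlt hb).ne
  · exact heq
  · exact absurd h (he.fst_lt _ _ hlt hb.symm).ne'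

theorem tabOf_eq_some_iff (he : IsPlacement r blk s e) {i : Fin ν} {c : Fin d} {v : Fin n} :
    tabOf blk s e i c = some v ↔ blk v = c ∧ (s (e v)).1 = i := by
  rw [tabOf]
  split_ifs with h
  · rw [Option.some.injEq]
    constructor
    · rintro rfl
      exact h.choose_spec
    · rintro ⟨h1, h2⟩
      exact he.eq_of_fst_eq (h.choose_spec.1.trans h1.symm) (h.choose_spec.2.trans h2.symm)
  · simp only [false_iff]
    exact fun hv => h ⟨v, hv⟩

theorem tabOf_isSome_iff (he : IsPlacement r blk s e) {i : Fin ν} {c : Fin d} :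
    (tabOf blk s e i c).isSome ↔ ∃ v, blk v = c ∧ (s (e v)).1 = i := by
  simp_rw [Option.isSome_iff_exists, he.tabOf_eq_some_iff]

theorem isFilling_tabOf (hd : 0 < d) (hs : IsSlotEnum r s) (he : IsPlacement r blk s e) :
    IsFilling r blk (tabOf blk s e) := by
  refine ⟨fun i hi c => ?_, fun i hi => ?_, fun c => ?_⟩
  · obtain ⟨k, hk⟩ := (hs.exists_iff (i, c)).2 (Or.inl hi)
    refine he.tabOf_isSome_iff.2 ⟨e.symm k, ?_⟩
    have := he.snd_eq (e.symm k)
    rw [Equiv.apply_symm_apply, hk] at this ⊢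
    exact ⟨(this hi).symm, rfl⟩
  · obtain ⟨k, hk⟩ := (hs.exists_iff (i, ⟨0, hd⟩)).2 (Or.inr rfl)
    refine ⟨blk (e.symm k), he.tabOf_isSome_iff.2 ⟨e.symm k, rfl, by simp [hk]⟩, fun c hc => ?_⟩
    obtain ⟨v, rfl, hv⟩ := he.tabOf_isSome_iff.1 hc
    have : e v = k := hs.eq_of_fst_eq (by rw [hv, hk]) fun h => absurd (hv ▸ h) (not_lt.2 hi)
    rw [← this, e.symm_apply_apply]
  · rw [colList_eq_sort_iff]
    simp_rw [he.tabOf_eq_some_iff]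
    refine ⟨fun v => by simp, ?_⟩
    rintro i i' v v' hi ⟨hv, rfl⟩ ⟨hv', rfl⟩
    by_contra hlt
    rcases (not_lt.1 hlt).lt_or_eq with h | h
    · exact hi.asymm (he.fst_lt _ _ h (hv'.trans hv.symm))
    · exact hi.ne (by rw [h])

theorem cells_tabOf (hd : 0 < d) (hs : IsSlotEnum r s) (he : IsPlacement r blk s e) :
    cells (tabOf blk s e) = List.ofFn fun k => (blk (e.symm k), e.symm k) := by
  set f : Fin n → Fin d × Fin n := fun k => (blk (e.symm k), e.symm k) with hf
  set G : Fin ν × Fin d → Option (Fin d × Fin n) :=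
    fun p => (Function.partialInv s p).map f with hG
  have hGs : ∀ k, G (s k) = some (f k) := fun k => by
    rw [hG]
    simp only [Function.partialInv_left hs.injective, Option.map_some]
  have hT : ∀ k, tabOf blk s e (s k).1 (blk (e.symm k)) = some (e.symm k) := fun k =>
    he.tabOf_eq_some_iff.2 ⟨rfl, by rw [e.apply_symm_apply]⟩
  have hofFn : List.ofFn f = (slotList ν d r).filterMap G := by
    rw [← hs.ofFn_eq, List.ofFn_eq_map, List.ofFn_eq_map, List.filterMap_map,
      ← List.filterMap_eq_map]
    exact List.filterMap_congr fun k _ => (hGs k).symm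
  rw [hofFn, slotList, List.filterMap_flatMap, cells]
  congr 1
  funext i
  rw [List.filterMap_filterMap]
  by_cases hi : (i : ℕ) < r
  · refine List.filterMap_congr fun c _ => ?_
    obtain ⟨k, hk⟩ := (hs.exists_iff (i, c)).2 (Or.inl hi)
    have hc := he.snd_eq (e.symm k)
    rw [e.apply_symm_apply, hk] at hc
    have h := hT k
    rw [← hc hi, hk] at h
    simp only [hi, true_or, if_true, Option.bind_some, ← hk, hGs]
    rw [h, Option.map_some, hf]
    simp only [← hc hi]
  · obtain ⟨k, hk⟩ := (hs.exists_iff (i, ⟨0, hd⟩)).2 (Or.inr rfl)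
    have h := hT k
    rw [hk] at h
    rw [filterMap_eq_singleton (a := blk (e.symm k)) (b := f k) (by rw [h]; rfl)
      (List.nodup_finRange d) (List.mem_finRange _),
      filterMap_eq_singleton (a := ⟨0, hd⟩) (b := f k) (by simp [← hk, hGs])
      (List.nodup_finRange d) (List.mem_finRange _)]
    · intro c hc
      have : (c : ℕ) ≠ 0 := fun h0 => hc (Fin.ext h0)
      simp [hi, this]
    · intro c hc
      rw [Option.map_eq_none_iff, ← Option.not_isSome_iff_eq_none, he.tabOf_isSome_iff]
      rintro ⟨v, rfl, hv⟩
      have : e v = k := hs.eq_of_fst_eq (by rw [hv, hk]) fun h => absurd (hv ▸ h) hi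
      rw [← this, e.symm_apply_apply] at hc
      exact hc rfl

theorem tabOf_injective (hs : IsSlotEnum r s) {e' : Equiv.Perm (Fin n)}
    (he : IsPlacement r blk s e) (he' : IsPlacement r blk s e')
    (h : tabOf blk s e = tabOf blk s e') : e = e' := by
  ext1 v
  have h1 : tabOf blk s e (s (e v)).1 (blk v) = some v := he.tabOf_eq_some_iff.2 ⟨rfl, rfl⟩
  rw [h, he'.tabOf_eq_some_iff] at h1
  refine hs.eq_of_fst_eq h1.2.symm fun hr => ?_
  rw [he.snd_eq v hr, he'.snd_eq v (by rwa [h1.2])]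

theorem labels_injective {e' : Equiv.Perm (Fin n)}
    (he : IsPlacement r blk s e) (he' : IsPlacement r blk s e')
    (h : ∀ k, blk (e.symm k) = blk (e'.symm k)) : e = e' := by
  have key : ∀ {e e' : Equiv.Perm (Fin n)}, IsPlacement r blk s e → IsPlacement r blk s e' →
      (∀ k, blk (e.symm k) = blk (e'.symm k)) → ∀ v, v ≤ e'.symm (e v) := by
    intro e e' he he' h v
    induction v using WellFoundedLT.induction with
    | _ v ih =>
      by_contra hlt
      rw [not_le] at hlt
      set u := e'.symm (e v) with hu
      have hb : blk u = blk v := by rw [hu, ← h, e.symm_apply_apply]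
      have h1 := he.fst_lt _ _ hlt hb
      have h2 := ih u hlt
      have hb' : blk (e'.symm (e u)) = blk u := by rw [← h, e.symm_apply_apply]
      have h3 : (s (e' u)).1 ≤ (s (e' (e'.symm (e u)))).1 := by
        rcases h2.lt_or_eq with h2 | h2
        · exact (he'.fst_lt _ _ h2 hb'.symm).le
        · rw [← h2]
      rw [e'.apply_symm_apply, hu, e'.apply_symm_apply] at h3
      exact absurd h1 (not_lt.2 h3)
  ext1 v
  have h1 := key he he' h v
  have h2 := key he' he (fun k => (h k).symm) (e'.symm (e v))
  rw [e'.apply_symm_apply, e.symm_apply_apply] at h2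
  rw [← e'.symm_apply_eq]
  exact le_antisymm h2 h1

end IsPlacement

theorem IsFilling.exists_placement {blk : Fin n → Fin d} {s : Fin n → Fin ν × Fin d}
    (hd : 0 < d) (hs : IsSlotEnum r s) {T : Tab ν n d} (hT : IsFilling r blk T) :
    ∃ e : Equiv.Perm (Fin n), IsPlacement r blk s e ∧ tabOf blk s e = T := by
  obtain ⟨h1, h2, h3⟩ := hT
  simp_rw [colList_eq_sort_iff] at h3
  have hex : ∀ v, ∃ k, T (s k).1 (blk v) = some v ∧ (((s k).1 : ℕ) < r → (s k).2 = blk v) := by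
    intro v
    obtain ⟨i, hi⟩ := ((h3 (blk v)).1 v).1 (by simp)
    by_cases hr : (i : ℕ) < r
    · obtain ⟨k, hk⟩ := (hs.exists_iff (i, blk v)).2 (Or.inl hr)
      exact ⟨k, by rw [hk]; exact ⟨hi, fun _ => rfl⟩⟩
    · obtain ⟨k, hk⟩ := (hs.exists_iff (i, ⟨0, hd⟩)).2 (Or.inr rfl)
      exact ⟨k, by rw [hk]; exact ⟨hi, fun h => absurd h hr⟩⟩
  choose e he hcol using hex
  have hinj : Function.Injective e := by
    intro v v' hv
    have hb : blk v = blk v' := by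
      by_cases hr : ((s (e v)).1 : ℕ) < r
      · rw [← hcol v hr, ← hcol v' (hv ▸ hr), hv]
      · refine (h2 _ (not_lt.1 hr)).unique ?_ ?_
        · rw [he]; rfl
        · rw [hv, he]; rfl
    have h := he v
    rw [hv, hb, he v', Option.some.injEq] at h
    exact h.symm
  let e' : Equiv.Perm (Fin n) := Equiv.ofBijective e (Finite.injective_iff_bijective.1 hinj)
  have hlt : ∀ v v', v < v' → blk v = blk v' → (s (e v)).1 < (s (e v')).1 := by
    intro v v' hv hb
    by_contra hlt
    have hv' := he v'
    rw [← hb] at hv'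
    rcases (not_lt.1 hlt).lt_or_eq with h | h
    · exact hv.asymm ((h3 _).2 _ _ _ _ h hv' (he v))
    · rw [h, he v, Option.some.injEq] at hv'
      exact hv.ne hv'
  have hp : IsPlacement r blk s e' := ⟨hcol, hlt⟩
  refine ⟨e', hp, ?_⟩
  ext i c v
  rw [hp.tabOf_eq_some_iff]
  constructor
  · rintro ⟨rfl, rfl⟩
    exact he v
  · intro h
    have hb : blk v = c := by simpa using ((h3 c).1 v).2 ⟨i, h⟩
    subst hb
    refine ⟨rfl, ?_⟩
    rcases lt_trichotomy (s (e v)).1 i with hi | hi | hi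
    · exact absurd ((h3 _).2 _ _ _ _ hi (he v) h) (lt_irrefl v)
    · exact hi
    · exact absurd ((h3 _).2 _ _ _ _ hi h (he v)) (lt_irrefl v)

end Placements

section SlotMatrix

variable {ν n d r : ℕ}

/-- The matrix whose determinant is the jellyfish invariant: its rows are indexed by the slots;
rows of column `0` are full rows of indeterminates, and a row of any other column `c` is
truncated to the block `c`. -/
noncomputable def slotMatrix (blk : Fin n → Fin d) (s : Fin n → Fin ν × Fin d) :
    Matrix (Fin n) (Fin n) (MvPolynomial (Fin ν × Fin n) ℂ) :=
  Matrix.of fun k j =>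
    if ((s k).2 : ℕ) = 0 ∨ blk j = (s k).2 then MvPolynomial.X ((s k).1, j) else 0

variable {blk : Fin n → Fin d} {s : Fin n → Fin ν × Fin d}

theorem snd_eq_of_det_labelled_ne_zero (hs : IsSlotEnum r s) {f : Fin n → Fin d}
    (hf : (labelled (slotMatrix blk s) f blk).det ≠ 0) (k : Fin n) (hk : ((s k).1 : ℕ) < r) :
    (s k).2 = f k := by
  have hrow : ∀ k, ((s k).2 : ℕ) ≠ 0 → (s k).2 = f k := by
    intro k h0
    by_contra hne
    refine hf (Matrix.det_eq_zero_of_row_eq_zero k fun j => ?_)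
    simp only [labelled, slotMatrix, Matrix.of_apply, h0, false_or]
    split_ifs with h1 h2
    · exact absurd (h2.symm.trans h1.symm) hne
    · rfl
    · rfl
  by_contra hne
  have h0 : ((s k).2 : ℕ) = 0 := by
    by_contra h0
    exact hne (hrow k h0)
  obtain ⟨k', hk'⟩ := (hs.exists_iff ((s k).1, f k)).2 (Or.inl hk)
  have hfk : (f k : ℕ) ≠ 0 := fun h => hne (Fin.ext (h0.trans h.symm))
  have hfk' : f k = f k' := by simpa [hk'] using hrow k' (by rwa [hk'])
  have hkk : k ≠ k' := by
    rintro rfl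
    exact hne (congrArg Prod.snd hk')
  refine hf (Matrix.det_zero_of_row_eq hkk ?_)
  funext j
  simp only [labelled, slotMatrix, Matrix.of_apply, h0, hk', hfk, ← hfk', true_or, if_true,
    false_or]
  split_ifs with h1 h2
  · rfl
  · exact absurd h1.symm h2
  · rfl

theorem exists_placement_of_labels (hs : IsSlotEnum r s) {f : Fin n → Fin d}
    (w : Equiv.Perm (Fin n)) (hw : ∀ k, f k = blk (w k))
    (hf : ∀ k, ((s k).1 : ℕ) < r → (s k).2 = f k) :
    ∃ e : Equiv.Perm (Fin n), IsPlacement r blk s e ∧ ∀ k, blk (e.symm k) = f k := by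
  have hfib : ∀ c, ∃ E : {k // blk k = c} ≃ {k // f k = c},
      ∀ v v', v < v' → (s (E v)).1 < (s (E v')).1 := by
    intro c
    have hinj : Function.Injective fun k : {k // f k = c} => (s k).1 := fun k k' h =>
      Subtype.ext (hs.eq_of_fst_eq h fun hr => by
        have hr' : ((s k').1 : ℕ) < r := by
          rwa [show (s k').1 = (s k).1 from h.symm]
        rw [hf _ hr, hf _ hr', k.2, k'.2])
    have hcard : (Finset.univ.image fun k : {k // f k = c} => (s k).1).card =
        (Finset.univ.image (Subtype.val : {k // blk k = c} → Fin n)).card := by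
      rw [Finset.card_image_of_injective _ hinj,
        Finset.card_image_of_injective _ Subtype.val_injective, Finset.card_univ, Finset.card_univ]
      exact Fintype.card_congr (w.subtypeEquiv fun k => by rw [hw])
    obtain ⟨a, ha⟩ := exists_equiv_comp_eq_orderEmbOfFin hinj hcard
    obtain ⟨b, hb⟩ := exists_equiv_comp_eq_orderEmbOfFin
      (Subtype.val_injective (p := fun k => blk k = c)) rfl
    refine ⟨b.symm.trans a, fun v v' hv => ?_⟩
    obtain ⟨i, rfl⟩ := b.surjective v
    obtain ⟨i', rfl⟩ := b.surjective v'
    have hlt : i < i' := by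
      have : (b i : Fin n) < b i' := hv
      rw [hb, hb] at this
      simpa using this
    simp only [Equiv.trans_apply, Equiv.symm_apply_apply]
    have := ((Finset.univ.image fun k : {k // f k = c} => (s k).1).orderEmbOfFin
      hcard).strictMono hlt
    rwa [← ha, ← ha] at this
  choose E hE using hfib
  have hmap : ∀ v, f (Equiv.ofFiberEquiv E v) = blk v := Equiv.ofFiberEquiv_map E
  refine ⟨Equiv.ofFiberEquiv E, ⟨fun v hr => (hf _ hr).trans (hmap v), fun v v' hv hb => ?_⟩,
    fun k => ?_⟩
  · have h := hE (blk v) ⟨v, rfl⟩ ⟨v', hb.symm⟩ hv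
    have h1 : ∀ c (h : blk v' = c), ((E c ⟨v', h⟩ : {k // f k = c}) : Fin n) =
        Equiv.ofFiberEquiv E v' := by
      rintro c rfl
      rfl
    rw [h1] at h
    exact h
  · rw [← hmap, Equiv.apply_symm_apply]

theorem det_labelled_placement (hd : 0 < d) (hs : IsSlotEnum r s) {e : Equiv.Perm (Fin n)}
    (he : IsPlacement r blk s e) :
    (labelled (slotMatrix blk s) (fun k => blk (e.symm k)) blk).det =
      (tabSign (tabOf blk s e) : ℂ) •
        JProd (fun c => Finset.univ.filter fun v => blk v = c) (tabOf blk s e) := by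
  rw [det_labelled_of_perm _ _ _ e.symm fun _ => rfl, tabSign, he.cells_tabOf hd hs,
    neg_one_pow_invList_eq_sign, JProd, MvPolynomial.smul_eq_C_mul, map_intCast]
  congr 1
  refine Finset.prod_congr rfl fun c _ => ?_
  have h := minor_image_eq_of_monotone (h := fun v : {v // blk v = c} => (s (e v)).1)
    (q := Subtype.val) Subtype.val_injective
    fun v v' hv => he.fst_lt _ _ hv (v.2.trans v'.2.symm)
  have hR : (Finset.univ.image fun v : {v // blk v = c} => (s (e v)).1) =
      rowsUsed (tabOf blk s e) c := by
    ext i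
    simp [rowsUsed, he.tabOf_isSome_iff]
  have hP : (Finset.univ.image (Subtype.val : {v // blk v = c} → Fin n)) =
      Finset.univ.filter fun v => blk v = c := by
    ext v
    simp
  rw [hR, hP] at h
  rw [h]
  congr 1
  ext1 v v'
  simp only [slotMatrix, Matrix.of_apply, Equiv.symm_symm]
  rw [if_pos]
  by_cases hr : ((s (e v)).1 : ℕ) < r
  · right
    rw [he.snd_eq _ hr, v.2, v'.2]
  · exact Or.inl (hs.snd_eq_zero hr)

theorem sum_jelly_eq_det (hd : 0 < d) (hs : IsSlotEnum r s) :
    (∑ T : Tab ν n d, if IsFilling r blk T then (tabSign T : ℂ) •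
        JProd (fun c => Finset.univ.filter fun v => blk v = c) T else 0) =
      (slotMatrix blk s).det := by
  rw [det_eq_sum_rowLabels _ blk, ← Finset.sum_filter]
  transitivity ∑ e ∈ Finset.univ.filter (IsPlacement r blk s), (tabSign (tabOf blk s e) : ℂ) •
    JProd (fun c => Finset.univ.filter fun v => blk v = c) (tabOf blk s e)
  · symm
    refine Finset.sum_bij (fun e _ => tabOf blk s e) ?_ ?_ ?_ fun _ _ => rfl
    · intro e he
      exact Finset.mem_filter.2 ⟨Finset.mem_univ _,
        (Finset.mem_filter.1 he).2.isFilling_tabOf hd hs⟩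
    · intro e he e' he' h
      exact (Finset.mem_filter.1 he).2.tabOf_injective hs (Finset.mem_filter.1 he').2 h
    · intro T hT
      obtain ⟨e, he, h⟩ := (Finset.mem_filter.1 hT).2.exists_placement hd hs
      exact ⟨e, Finset.mem_filter.2 ⟨Finset.mem_univ _, he⟩, h⟩
  · refine Finset.sum_of_injOn (fun e k => blk (e.symm k)) ?_ (fun _ _ => Finset.mem_univ _) ?_ ?_
    · intro e he e' he' h
      simp only [Finset.coe_filter, Finset.mem_univ, true_and, Set.mem_ofPred_eq] at he he'
      exact he.labels_injective he' (congrFun h)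
    · intro f _ hf
      by_contra hne
      obtain ⟨w, hw⟩ := exists_perm_of_det_labelled_ne_zero _ _ _ hne
      obtain ⟨e, he, hef⟩ := exists_placement_of_labels hs w hw
        (snd_eq_of_det_labelled_ne_zero hs hne)
      exact hf ⟨e, by simpa using he, funext hef⟩
    · intro e he
      exact (det_labelled_placement hd hs (Finset.mem_filter.1 he).2).symm

theorem det_labelled_slots_eq (hr : r ≤ ν) (hs : IsSlotEnum r s) {g : Fin n → Fin d}
    (h : (labelled (slotMatrix blk s) (fun k => (s k).2) g).det ≠ 0) :
    (∀ c, (Finset.univ.filter fun j => g j = c).card = if (c : ℕ) = 0 then ν else r) ∧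
    ∃ z : ℤ, (labelled (slotMatrix blk s) (fun k => (s k).2) g).det =
      z • ∏ c, topMinor ν n (Finset.univ.filter fun j => g j = c) := by
  obtain ⟨w, hw⟩ := exists_perm_of_det_labelled_ne_zero _ _ _ h
  have hcol : ∀ j, (g j : ℕ) = 0 ∨ blk j = g j := by
    intro j
    by_contra hj
    refine h (Matrix.det_eq_zero_of_column_eq_zero j fun k => ?_)
    simp only [labelled, slotMatrix, Matrix.of_apply]
    split_ifs with h1 h2
    · rw [h1] at h2
      exact absurd h2 hj
    · rfl
    · rfl
  have hsnd : ∀ j, (s (w.symm j)).2 = g j := fun j => by rw [hw, w.apply_symm_apply]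
  have hinj : ∀ c, Function.Injective fun j : {j // g j = c} => (s (w.symm j)).1 := by
    intro c j j' hj
    refine Subtype.ext (w.symm.injective (hs.injective (Prod.ext hj ?_)))
    rw [hsnd, hsnd, j.2, j'.2]
  have himg : ∀ c : Fin d, (Finset.univ.image fun j : {j // g j = c} => (s (w.symm j)).1) =
      topRows ν (if (c : ℕ) = 0 then ν else r) := by
    intro c
    ext i
    have hi : (∃ j : {j // g j = c}, (s (w.symm j)).1 = i) ↔ ∃ k, s k = (i, c) := by
      constructor
      · rintro ⟨j, rfl⟩
        exact ⟨w.symm j, Prod.ext rfl (by rw [hsnd, j.2])⟩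
      · rintro ⟨k, hk⟩
        exact ⟨⟨w k, by rw [← hw, hk]⟩, by simp [hk]⟩
    simp only [Finset.mem_image, Finset.mem_univ, true_and, hi, hs.exists_iff, topRows,
      Finset.mem_filter]
    split_ifs with h0
    · simp [h0]
    · simp [h0]
  have hval : ∀ c, (Finset.univ.image (Subtype.val : {j // g j = c} → Fin n)) =
      Finset.univ.filter fun j => g j = c := by
    intro c
    ext v
    simp
  have hcard : ∀ c, (Finset.univ.filter fun j => g j = c).card =
      if (c : ℕ) = 0 then ν else r := by
    intro c
    rw [← hval, Finset.card_image_of_injective _ Subtype.val_injective,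
      ← Finset.card_image_of_injective _ (hinj c), himg, topRows, card_filter_val_lt]
    split_ifs
    · exact le_rfl
    · exact hr
  refine ⟨hcard, ?_⟩
  have hblock : ∀ c, ∃ z : ℤˣ, (Matrix.of fun j j' : {j // g j = c} =>
      slotMatrix blk s (w.symm j) j').det = ((z : ℤ) : MvPolynomial (Fin ν × Fin n) ℂ) *
        topMinor ν n (Finset.univ.filter fun j => g j = c) := by
    intro c
    obtain ⟨z, hz⟩ := det_X_eq_sign_mul_minor_image (hinj c) Subtype.val_injective
    refine ⟨z, ?_⟩
    rw [himg, hval, ← hcard] at hz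
    rw [topMinor, ← hz]
    congr 1
    ext1 j j'
    simp only [slotMatrix, Matrix.of_apply]
    rw [if_pos]
    rw [hsnd, j.2]
    simpa only [j'.2] using hcol j'
  choose z hz using hblock
  refine ⟨Equiv.Perm.sign w * ∏ c, (z c : ℤ), ?_⟩
  rw [det_labelled_of_perm _ _ _ w hw]
  simp_rw [hz]
  rw [Finset.prod_mul_distrib, zsmul_eq_mul]
  push_cast
  ring

end SlotMatrix

/-- every `r`-jellyfish invariant `[π]_r` lies in the flamingo Specht
module `S^{(d^r, 1^{n−rd})}`, i.e. in the span of the products `∏_i p_{J_i}`. -/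
theorem statement6 (n d r : ℕ) (hn : 0 < n) (hd : 0 < d) (hr : 0 < r)
    (hrd : r * d ≤ n)
    (π : Fin d → Finset (Fin n)) (hπ : IsOSP n d r π) :
    jellyInv n d r π ∈ Submodule.span ℂ (flamingoSet n d r) := by
  obtain ⟨-, hdisj, hunion⟩ := hπ
  have hex : ∀ v, ∃ c, v ∈ π c := fun v => by
    have hv := Finset.mem_univ v
    rw [← hunion] at hv
    simpa using hv
  choose blk hblk using hex
  obtain rfl : π = fun c => Finset.univ.filter fun v => blk v = c := by
    funext c
    ext v
    simp only [Finset.mem_filter, Finset.mem_univ, true_and]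
    refine ⟨fun hv => ?_, fun h => h ▸ hblk v⟩
    by_contra hne
    exact Finset.disjoint_left.1 (hdisj _ _ hne) (hblk v) hv
  have hle : r + (d - 1) * r ≤ n := by
    obtain ⟨d, rfl⟩ := Nat.exists_eq_succ_of_ne_zero hd.ne'
    calc r + (d + 1 - 1) * r = r * (d + 1) := by rw [Nat.add_sub_cancel]; ring
      _ ≤ n := hrd
  have hν : r ≤ n - (d - 1) * r := by omega
  obtain ⟨s, hs⟩ := exists_isSlotEnum (n := n) hd hν (by omega)
  have hdet : jellyInv n d r (fun c => Finset.univ.filter fun v => blk v = c) =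
      (slotMatrix blk s).det := sum_jelly_eq_det hd hs
  rw [hdet, det_eq_sum_colLabels _ fun k => (s k).2]
  refine Submodule.sum_mem _ fun g _ => ?_
  by_cases h : (labelled (slotMatrix blk s) (fun k => (s k).2) g).det = 0
  · rw [h]
    exact Submodule.zero_mem _
  · obtain ⟨hcard, z, hz⟩ := det_labelled_slots_eq hν hs h
    rw [hz]
    refine zsmul_mem (Submodule.subset_span ?_) z
    refine ⟨fun c => Finset.univ.filter fun j => g j = c, fun c c' hne => ?_, ?_, fun c hc => ?_,
      fun c hc => ?_, rfl⟩
    · exact Finset.disjoint_filter.2 fun v _ hv hv' => hne (hv.symm.trans hv')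
    · ext v
      simp
    · rw [hcard, if_pos hc]
    · rw [hcard, if_neg hc]

end Jellyfish
end

section
/- Let n, d, r be positive integers and let w be a permutation of [n]. Consider the action of the symmetric group S_n on the polynomial ring ℂ[x_{ij}] determined by w·x_{i,j} = x_{i,w(j)} (permuting the columns of the matrix of indeterminates). For any ordered set partition π ∈ OP(n,d,r), with w·π the ordered set partition whose blocks are (w·π_1 | … | w·π_d) where w·π_i = {w(b) : b ∈ π_i}, one has w·[π]_r = sgn(w)·[w·π]_r, where sgn(w) is the sign of the permutation w. -/
open scoped Classical

namespace Jellyfish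

section AdjacentSwap

variable {n : ℕ} {x y : Fin n}

theorem swap_lt_swap_iff_of_adjacent (hxy : (x : ℕ) + 1 = y) {a b : Fin n}
    (h₁ : ¬(a = x ∧ b = y)) (h₂ : ¬(a = y ∧ b = x)) :
    Equiv.swap x y a < Equiv.swap x y b ↔ a < b := by
  simp only [Equiv.swap_apply_def, Fin.lt_def, Fin.ext_iff] at *
  split_ifs <;> omega

theorem invList_map_swap_of_not_mem {d : ℕ} (hxy : (x : ℕ) + 1 = y) (l : List (Fin d × Fin n))
    (h : ¬(x ∈ l.map Prod.snd ∧ y ∈ l.map Prod.snd)) :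
    invList (l.map (Prod.map id (Equiv.swap x y))) = invList l := by
  induction l with
  | nil => rfl
  | cons a l ih =>
    simp only [List.map_cons, invList, List.countP_map]
    rw [ih fun hl => h (by simp_all)]
    congr 1
    refine List.countP_congr fun b hb => ?_
    have hb' : b.2 ∈ l.map Prod.snd := List.mem_map_of_mem hb
    simp only [Function.comp_apply, Prod.map_snd, decide_eq_true_eq]
    exact swap_lt_swap_iff_of_adjacent hxy
      (by rintro ⟨rfl, h'⟩; simp_all) (by rintro ⟨h', rfl⟩; simp_all)

theorem neg_one_pow_invList_map_swap {d : ℕ} (hxy : (x : ℕ) + 1 = y) (l : List (Fin d × Fin n))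
    (hl : (l.map Prod.snd).Nodup) (hx : x ∈ l.map Prod.snd) (hy : y ∈ l.map Prod.snd) :
    (-1 : ℤ) ^ invList (l.map (Prod.map id (Equiv.swap x y))) = -(-1) ^ invList l := by
  have hne : x ≠ y := by rintro rfl; omega
  have count_lt : ∀ l : List (Fin d × Fin n), y ∈ l.map Prod.snd → x ∉ l.map Prod.snd →
      (l.map Prod.snd).Nodup → l.countP (fun b => decide (Equiv.swap x y b.2 < y)) =
        l.countP (fun b => decide (b.2 < x)) + 1 := by
    intro l hy hx hl
    have key : (l.map Prod.snd).countP (fun b => decide (Equiv.swap x y b < y)) =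
        (l.map Prod.snd).countP (fun b => decide (b < x)) + 1 := by
      generalize l.map Prod.snd = m at hy hx hl
      obtain ⟨s, t, rfl⟩ := List.append_of_mem hy
      have hcongr : ∀ u : List (Fin n), x ∉ u → y ∉ u →
          u.countP (fun b => decide (Equiv.swap x y b < y)) =
            u.countP (fun b => decide (b < x)) := by
        intro u hxu hyu
        refine List.countP_congr fun b hb => ?_
        have h1 : b ≠ x := fun h => hxu (h ▸ hb)
        have h2 : b ≠ y := fun h => hyu (h ▸ hb)
        rw [Equiv.swap_apply_of_ne_of_ne h1 h2]
        simp only [decide_eq_true_eq, Fin.lt_def]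
        have := Fin.val_ne_of_ne h1
        omega
      have hs : y ∉ s := by
        intro h
        exact (List.nodup_append.1 hl).2.2 y h y (by simp) rfl
      have ht : y ∉ t := (List.nodup_cons.1 (List.nodup_append.1 hl).2.1).1
      have h3 : x < y := by rw [Fin.lt_def]; omega
      simp only [List.mem_append, List.mem_cons, not_or] at hx
      simp [List.countP_append, hcongr s hx.1 hs, hcongr t hx.2.2 ht, h3,
        h3.le, add_assoc]
    simpa [List.countP_map, Function.comp_def] using key
  have count_lt' : ∀ l : List (Fin d × Fin n), x ∈ l.map Prod.snd → y ∉ l.map Prod.snd →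
      (l.map Prod.snd).Nodup → l.countP (fun b => decide (b.2 < y)) =
        l.countP (fun b => decide (Equiv.swap x y b.2 < x)) + 1 := by
    intro l hx hy hl
    have hinv : (l.map (Prod.map id (Equiv.swap x y))).map Prod.snd =
        (l.map Prod.snd).map (Equiv.swap x y) := by simp [Function.comp_def]
    have := count_lt (l.map (Prod.map id (Equiv.swap x y)))
      (by rw [hinv]; exact List.mem_map.2 ⟨x, hx, by simp⟩)
      (by
        rw [hinv]
        rintro h
        obtain ⟨b, hb, hbx⟩ := List.mem_map.1 h
        rw [Equiv.swap_apply_eq_iff, Equiv.swap_apply_left] at hbx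
        exact hy (hbx ▸ hb))
      (by rw [hinv]; exact hl.map (Equiv.injective _))
    simpa [List.countP_map, Function.comp_def] using this
  induction l with
  | nil => simp at hx
  | cons a l ih =>
    have hcons : invList ((a :: l).map (Prod.map id (Equiv.swap x y))) =
        l.countP (fun b => decide (Equiv.swap x y b.2 < Equiv.swap x y a.2)) +
          invList (l.map (Prod.map id (Equiv.swap x y))) := by
      simp only [List.map_cons, invList, List.countP_map]
      rfl
    rw [hcons, invList]
    rw [List.map_cons, List.nodup_cons] at hl
    rw [List.map_cons, List.mem_cons] at hx hy
    by_cases hax : a.2 = x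
    · have hy' := hy.resolve_left fun h => hne (hax.symm.trans h.symm)
      rw [hax] at hl
      rw [invList_map_swap_of_not_mem hxy l fun h => hl.1 h.1, hax, Equiv.swap_apply_left,
        count_lt l hy' hl.1 hl.2]
      ring
    · have hx' := hx.resolve_left fun h => hax h.symm
      by_cases hay : a.2 = y
      · rw [hay] at hl
        rw [invList_map_swap_of_not_mem hxy l fun h => hl.1 h.2, hay, Equiv.swap_apply_right,
          count_lt' l hx' hl.1 hl.2]
        ring
      · have hy' := hy.resolve_left fun h => hay h.symm
        rw [pow_add, ih hl.2 hx' hy', pow_add]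
        have : l.countP (fun b => decide (Equiv.swap x y b.2 < Equiv.swap x y a.2)) =
            l.countP (fun b => decide (b.2 < a.2)) := by
          refine List.countP_congr fun b _ => ?_
          simp only [decide_eq_true_eq]
          exact swap_lt_swap_iff_of_adjacent hxy (fun h => hay h.2) (fun h => hax h.2)
        rw [this]
        ring

end AdjacentSwap

/-- Apply a permutation of the entries to every cell of a tableau. -/
def relabel {ν n d : ℕ} (w : Equiv.Perm (Fin n)) : Tab ν n d ≃ Tab ν n d :=
  Equiv.piCongrRight fun _ => Equiv.piCongrRight fun _ => Equiv.optionCongr w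

section Relabel

variable {ν n d : ℕ} (w : Equiv.Perm (Fin n)) (T : Tab ν n d)

theorem relabel_apply (i : Fin ν) (j : Fin d) : relabel w T i j = (T i j).map w := rfl

theorem colList_relabel (j : Fin d) : colList (relabel w T) j = (colList T j).map w := by
  simp [colList, relabel_apply, List.map_filterMap]

theorem cells_relabel : cells (relabel w T) = (cells T).map (Prod.map id w) := by
  simp [cells, relabel_apply, List.map_flatMap, List.map_filterMap, Function.comp_def]

theorem rowsUsed_relabel (j : Fin d) : rowsUsed (relabel w T) j = rowsUsed T j := by
  simp [rowsUsed, relabel_apply]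

end Relabel

section Jelly

variable {n d r : ℕ} {π : Fin d → Finset (Fin n)}

theorem IsOSP.image (hπ : IsOSP n d r π) (w : Equiv.Perm (Fin n)) :
    IsOSP n d r (fun j => (π j).image w) := by
  obtain ⟨h1, h2, h3⟩ := hπ
  refine ⟨fun j => ?_, fun j k hjk => ?_, ?_⟩
  · rw [Finset.card_image_of_injective _ w.injective]
    exact h1 j
  · exact (Finset.disjoint_image w.injective).2 (h2 j k hjk)
  · rw [← Finset.biUnion_image, h3, Finset.image_univ_equiv]

theorem isJelly_relabel_iff {w : Equiv.Perm (Fin n)} (hw : ∀ j, StrictMonoOn w (π j))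
    (T : Tab (n - (d-1)*r) n d) :
    IsJelly n d r (fun j => (π j).image w) (relabel w T) ↔ IsJelly n d r π T := by
  have hsort : ∀ j, ((π j).image w).sort (· ≤ ·) = ((π j).sort (· ≤ ·)).map w := by
    intro j
    have hmap : (π j).image w = (π j).map w.toEmbedding := by
      simp only [Finset.map_eq_image, Equiv.coe_toEmbedding]
    rw [hmap]
    exact (StrictMonoOn.map_finsetSort w.toEmbedding (π j) (hw j)).symm
  simp only [IsJelly, relabel_apply, Option.isSome_map, colList_relabel, hsort,
    w.injective.list_map.eq_iff]

theorem IsJelly.nodup_word {T : Tab (n - (d-1)*r) n d} (hT : IsJelly n d r π T)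
    (hπ : IsOSP n d r π) : ((cells T).map Prod.snd).Nodup := by
  have mem_block : ∀ i j v, T i j = some v → v ∈ π j := by
    intro i j v h
    rw [← Finset.mem_sort (· ≤ ·), ← hT.2.2 j]
    exact List.mem_filterMap.2 ⟨i, List.mem_finRange i, h⟩
  have block_unique : ∀ j k v, v ∈ π j → v ∈ π k → j = k := by
    intro j k v hj hk
    by_contra hjk
    exact Finset.disjoint_left.1 (hπ.2.1 j k hjk) hj hk
  have row_unique : ∀ i i' j v, T i j = some v → T i' j = some v → i = i' := by
    intro i i' j v h h'
    by_contra hii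
    have hnd : (colList T j).Nodup := by
      rw [hT.2.2 j]
      exact Finset.sort_nodup _ _
    rw [colList, List.Nodup, List.pairwise_filterMap] at hnd
    have hsymm : Std.Symm fun a b : Fin (n - (d-1)*r) =>
        ∀ u, T a j = some u → ∀ v, T b j = some v → u ≠ v :=
      ⟨fun a b hab v hv u hu => (hab u hu v hv).symm⟩
    exact hnd.forall (List.mem_finRange i) (List.mem_finRange i') hii v h v h' rfl
  rw [cells, List.map_flatMap, List.nodup_flatMap]
  simp only [List.map_filterMap, Option.map_map]
  refine ⟨fun i _ => ?_, ?_⟩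
  · rw [List.Nodup, List.pairwise_filterMap]
    refine (List.nodup_finRange d).imp ?_
    rintro j k hjk v hv u hu rfl
    simp at hv hu
    exact hjk (block_unique j k v (mem_block i j v hv) (mem_block i k v hu))
  · refine (List.nodup_finRange _).imp ?_
    intro i i' hii v hv hv'
    simp only [List.mem_filterMap] at hv hv'
    obtain ⟨j, _, hj⟩ := hv
    obtain ⟨k, _, hk⟩ := hv'
    simp at hj hk
    obtain rfl := block_unique j k v (mem_block i j v hj) (mem_block i' k v hk)
    exact hii (row_unique i i' j v hj hk)

theorem IsJelly.mem_word {T : Tab (n - (d-1)*r) n d} (hT : IsJelly n d r π T)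
    (hπ : IsOSP n d r π) (v : Fin n) : v ∈ (cells T).map Prod.snd := by
  obtain ⟨j, -, hj⟩ := Finset.mem_biUnion.1 (hπ.2.2 ▸ Finset.mem_univ v)
  rw [← Finset.mem_sort (· ≤ ·), ← hT.2.2 j] at hj
  obtain ⟨i, -, hi⟩ := List.mem_filterMap.1 hj
  simp only [cells, List.map_flatMap, List.map_filterMap, List.mem_flatMap, List.mem_filterMap]
  exact ⟨i, List.mem_finRange i, j, List.mem_finRange j, by simp [hi]⟩

theorem IsJelly.tabSign_relabel_swap {T : Tab (n - (d-1)*r) n d} (hT : IsJelly n d r π T)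
    (hπ : IsOSP n d r π) {x y : Fin n} (hxy : (x : ℕ) + 1 = y) :
    tabSign (relabel (Equiv.swap x y) T) = -tabSign T := by
  rw [tabSign, cells_relabel,
    neg_one_pow_invList_map_swap hxy _ (hT.nodup_word hπ) (hT.mem_word hπ x) (hT.mem_word hπ y),
    tabSign]

end Jelly

section Minor

variable {ν n : ℕ} (I : Finset (Fin ν)) (J : Finset (Fin n)) (w : Equiv.Perm (Fin n))

theorem rename_minor_of_strictMonoOn (hw : StrictMonoOn w J) :
    MvPolynomial.rename (fun p : Fin ν × Fin n => (p.1, w p.2)) (minor ν n I J) =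
      minor ν n I (J.image w) := by
  have hcard : (J.image w).card = J.card := Finset.card_image_of_injective _ w.injective
  unfold minor
  by_cases h : I.card = J.card
  · rw [dif_pos h, dif_pos (h.trans hcard.symm), AlgHom.map_det]
    congr 1
    ext1 a b
    have : w ∘ J.orderEmbOfFin h.symm = (J.image w).orderEmbOfFin (hcard.trans h.symm) := by
      refine Finset.orderEmbOfFin_unique _ (fun b => ?_) fun b c hbc => ?_
      · exact Finset.mem_image_of_mem _ (Finset.orderEmbOfFin_mem _ _ _)
      · exact hw (Finset.orderEmbOfFin_mem _ _ _) (Finset.orderEmbOfFin_mem _ _ _)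
          ((J.orderEmbOfFin h.symm).strictMono hbc)
    simp [← this]
  · rw [dif_neg h, dif_neg (by rwa [hcard]), map_zero]

theorem rename_minor_swap {x y : Fin n} (hne : x ≠ y) (hx : x ∈ J) (hy : y ∈ J) :
    MvPolynomial.rename (fun p : Fin ν × Fin n => (p.1, Equiv.swap x y p.2)) (minor ν n I J) =
      -minor ν n I J := by
  unfold minor
  by_cases h : I.card = J.card
  · rw [dif_pos h, AlgHom.map_det]
    set e := J.orderEmbOfFin h.symm with he
    have hrange : Set.range e = J := Finset.range_orderEmbOfFin _ _
    obtain ⟨b, rfl⟩ : x ∈ Set.range e := by rw [hrange]; exact hx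
    obtain ⟨c, rfl⟩ : y ∈ Set.range e := by rw [hrange]; exact hy
    have hbc : b ≠ c := fun h => hne (by rw [h])
    rw [← neg_one_mul, show (-1 : MvPolynomial (Fin ν × Fin n) ℂ) =
      ((Equiv.Perm.sign (Equiv.swap b c) : ℤ) : MvPolynomial (Fin ν × Fin n) ℂ) by
        simp [Equiv.Perm.sign_swap hbc], ← Matrix.det_permute']
    congr 1
    ext1 a k
    simp [e.injective.swap_apply]
  · rw [dif_neg h, map_zero, neg_zero]

end Minor

section AdjacentAction

variable {n d r : ℕ} {π : Fin d → Finset (Fin n)} {x y : Fin n}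

theorem rename_jellyInv_swap_of_not_mem (hπ : IsOSP n d r π) (hxy : (x : ℕ) + 1 = y)
    (h : ∀ j, ¬(x ∈ π j ∧ y ∈ π j)) :
    MvPolynomial.rename (fun p : Fin (n - (d-1)*r) × Fin n => (p.1, Equiv.swap x y p.2))
        (jellyInv n d r π) =
      -jellyInv n d r (fun j => (π j).image (Equiv.swap x y)) := by
  have hmono : ∀ j, StrictMonoOn (Equiv.swap x y) (π j) := by
    intro j a ha b hb hab
    refine (swap_lt_swap_iff_of_adjacent hxy ?_ ?_).2 hab
    · rintro ⟨rfl, rfl⟩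
      exact h j ⟨ha, hb⟩
    · rintro ⟨rfl, rfl⟩
      exact h j ⟨hb, ha⟩
  unfold jellyInv
  rw [map_sum, ← Finset.sum_neg_distrib]
  refine Fintype.sum_equiv (relabel (Equiv.swap x y)) _ _ fun T => ?_
  simp only [isJelly_relabel_iff hmono]
  split_ifs with hT
  · rw [hT.tabSign_relabel_swap hπ hxy, map_smul, JProd, map_prod, JProd]
    simp only [rename_minor_of_strictMonoOn _ _ _ (hmono _), rowsUsed_relabel]
    simp
  · simp

theorem rename_jellyInv_swap_of_mem (hπ : IsOSP n d r π) (hne : x ≠ y) {j : Fin d}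
    (hx : x ∈ π j) (hy : y ∈ π j) :
    MvPolynomial.rename (fun p : Fin (n - (d-1)*r) × Fin n => (p.1, Equiv.swap x y p.2))
        (jellyInv n d r π) =
      -jellyInv n d r (fun j => (π j).image (Equiv.swap x y)) := by
  have hfix : ∀ k, k ≠ j → ∀ a ∈ π k, Equiv.swap x y a = a := by
    intro k hk a ha
    have := Finset.disjoint_left.1 (hπ.2.1 k j hk) ha
    exact Equiv.swap_apply_of_ne_of_ne (fun h => this (h ▸ hx)) (fun h => this (h ▸ hy))
  have himage : ∀ k, k ≠ j → (π k).image (Equiv.swap x y) = π k := by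
    intro k hk
    rw [Finset.image_congr (g := id) fun a ha => hfix k hk a ha, Finset.image_id]
  have himage' : (fun k => (π k).image (Equiv.swap x y)) = π := by
    funext k
    by_cases hk : k = j
    · subst hk
      refine Finset.eq_of_subset_of_card_le (fun a ha => ?_)
        (Finset.card_image_of_injective _ (Equiv.injective _)).ge
      obtain ⟨b, hb, rfl⟩ := Finset.mem_image.1 ha
      rw [Equiv.swap_apply_def]
      split_ifs <;> assumption
    · exact himage k hk
  rw [himage']
  unfold jellyInv
  rw [map_sum, ← Finset.sum_neg_distrib]
  refine Finset.sum_congr rfl fun T _ => ?_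
  split_ifs with hT
  · rw [map_smul, ← smul_neg, JProd, map_prod, ← Finset.mul_prod_erase _ _ (Finset.mem_univ j),
      rename_minor_swap _ _ hne hx hy, ← Finset.mul_prod_erase _ _ (Finset.mem_univ j),
      neg_mul]
    congr 3
    refine Finset.prod_congr rfl fun k hk => ?_
    have hkj := Finset.ne_of_mem_erase hk
    rw [rename_minor_of_strictMonoOn, himage k hkj]
    intro a ha b hb hab
    rwa [hfix k hkj a ha, hfix k hkj b hb]
  · simp

theorem rename_jellyInv_swap (hπ : IsOSP n d r π) (hxy : (x : ℕ) + 1 = y) :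
    MvPolynomial.rename (fun p : Fin (n - (d-1)*r) × Fin n => (p.1, Equiv.swap x y p.2))
        (jellyInv n d r π) =
      -jellyInv n d r (fun j => (π j).image (Equiv.swap x y)) := by
  by_cases h : ∃ j, x ∈ π j ∧ y ∈ π j
  · obtain ⟨j, hx, hy⟩ := h
    exact rename_jellyInv_swap_of_mem hπ (by rintro rfl; omega) hx hy
  · exact rename_jellyInv_swap_of_not_mem hπ hxy (not_exists.1 h)

end AdjacentAction

/-- for the action of `S_n` on `ℂ[x_{ij}]` permuting columns
(`w·x_{i,j} = x_{i,w(j)}`), one has `w·[π]_r = sgn(w)·[w·π]_r`. -/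
theorem statement7 (n d r : ℕ) (hn : 0 < n) (hd : 0 < d) (hr : 0 < r)
    (π : Fin d → Finset (Fin n)) (hπ : IsOSP n d r π) (w : Equiv.Perm (Fin n)) :
    MvPolynomial.rename (fun p : Fin (n - (d-1)*r) × Fin n => (p.1, w p.2))
        (jellyInv n d r π) =
      ((Equiv.Perm.sign w : ℤ) : ℂ) • jellyInv n d r (fun j => (π j).image w) := by
  obtain ⟨m, rfl⟩ := Nat.exists_eq_succ_of_ne_zero hn.ne'
  have hw : w ∈ Submonoid.closure
      (Set.range fun i : Fin m => Equiv.swap i.castSucc i.succ) := by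
    rw [Equiv.Perm.mclosure_swap_castSucc_succ]
    exact Submonoid.mem_top w
  induction hw using Submonoid.closure_induction generalizing π with
  | mem u hu =>
    obtain ⟨i, rfl⟩ := hu
    simp [rename_jellyInv_swap hπ (show ((i.castSucc : Fin (m + 1)) : ℕ) + 1 = i.succ by simp),
      Equiv.Perm.sign_swap i.castSucc_lt_succ.ne]
  | one => simp [← Function.id_def]
  | mul u v _ _ hu hv =>
    have hcomp : (fun p : Fin (m.succ - (d-1)*r) × Fin m.succ => (p.1, (u * v) p.2)) =
        (fun p => (p.1, u p.2)) ∘ fun p => (p.1, v p.2) := rfl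
    rw [hcomp, ← MvPolynomial.rename_rename, hv π hπ, map_smul, hu _ (hπ.image v), smul_smul]
    simp [Finset.image_image, Equiv.Perm.coe_mul, mul_comm]

end Jellyfish
end

section
/- Let r > 1 and let n, d be positive integers. For each noncrossing set partition γ ∈ NC(n,d,r), choose any ordering of its blocks to obtain an ordered set partition π_γ ∈ OP(n,d,r). Then the family of polynomials { [π_γ]_r : γ ∈ NC(n,d,r) } is linearly independent over ℂ. -/
open scoped Classical

namespace Jellyfish

section Triangular

/-- Dual functionals that are triangular with respect to a family of vectors witness its
linear independence. -/
theorem linearIndependent_of_triangular {ι V : Type*} [AddCommGroup V] [Module ℂ V]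
    (v : ι → V) (φ : ι → V →ₗ[ℂ] ℂ) (s : ι → ℤ) (hdiag : ∀ i, φ i (v i) ≠ 0)
    (hoff : ∀ i j, φ i (v j) ≠ 0 → s j ≤ s i → j = i) :
    LinearIndependent ℂ v := by
  rw [linearIndependent_iff']
  intro t g hg
  by_contra! hne
  obtain ⟨k, hk, hgk⟩ := hne
  obtain ⟨i, hi, hmax⟩ := (t.filter (fun i => g i ≠ 0)).exists_max_image s
    ⟨k, by simp [hk, hgk]⟩
  rw [Finset.mem_filter] at hi
  have h := congrArg (φ i) hg
  rw [map_sum, map_zero, Finset.sum_eq_single i] at h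
  · simp [hi.2, hdiag i] at h
  · intro j hj hji
    by_contra hne
    rw [map_smul, smul_eq_mul] at hne
    exact hji (hoff i j (right_ne_zero_of_mul hne)
      (hmax j (by simp [hj, left_ne_zero_of_mul hne])))
  · exact fun h => absurd hi.1 h

end Triangular

section Noncrossing

variable {α : Type*} [LinearOrder α]

/-- If two noncrossing equivalence relations with the same block maxima agree below `x`, then
the predecessor of `x` in its block for the second is at most the one for the first. -/
theorem predecessor_le_of_noncrossing {p q : Setoid α}
    (hp : ∀ a b c e, a < b → b < c → c < e → p a c → p b e → p a b)
    (hmax : ∀ x, (∀ y, p x y → y ≤ x) → ∀ y, q x y → y ≤ x)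
    (hfin : ∀ x, ∃ m, p x m ∧ ∀ y, p x y → y ≤ m)
    {x y z : α} (hagree : ∀ a < x, ∀ b < x, p a b → q a b)
    (hyx : p y x) (hygreatest : ∀ w < x, p w x → w ≤ y)
    (hzlt : z < x) (hzx : q z x) : z ≤ y := by
  by_contra! hyz
  have hzx' : ¬ p z x := fun h => (hygreatest z hzlt h).not_gt hyz
  obtain ⟨m, hzm, hm⟩ := hfin z
  have hmx : m < x := by
    rcases lt_trichotomy m x with h | h | h
    · exact h
    · exact absurd (h ▸ hzm) hzx'
    · exact absurd (p.trans (p.symm (hp y z x m hyz hzlt h hyx hzm)) hyx) hzx'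
  have hmm : ∀ w, p m w → w ≤ m := fun w hw => hm w (p.trans hzm hw)
  have hqmz : q m z := hagree m hmx z hzlt (p.symm hzm)
  exact (hmax m hmm x (q.trans hqmz hzx)).not_gt hmx

/-- A noncrossing equivalence relation on a finite chain is determined by its block minima
and block maxima. -/
theorem noncrossing_setoid_ext [Finite α] {p q : Setoid α}
    (hp : ∀ a b c e, a < b → b < c → c < e → p a c → p b e → p a b)
    (hq : ∀ a b c e, a < b → b < c → c < e → q a c → q b e → q a b)
    (hmin : ∀ x, (∀ y, p x y → x ≤ y) ↔ ∀ y, q x y → x ≤ y)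
    (hmax : ∀ x, (∀ y, p x y → y ≤ x) ↔ ∀ y, q x y → y ≤ x) : p = q := by
  have hfin : ∀ s : Setoid α, ∀ x, ∃ m, s x m ∧ ∀ y, s x y → y ≤ m := fun s x => by
    obtain ⟨m, hm, hm'⟩ := Set.exists_max_image {y | s x y} id (Set.toFinite _) ⟨x, s.refl x⟩
    exact ⟨m, hm, hm'⟩
  have hpred : ∀ s : Setoid α, ∀ x, (∃ y < x, s y x) →
      ∃ y, y < x ∧ s y x ∧ ∀ w < x, s w x → w ≤ y := fun s x ⟨y, hy, hyx⟩ => by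
    obtain ⟨m, hm, hm'⟩ := Set.exists_max_image {y | y < x ∧ s y x} id (Set.toFinite _)
      ⟨y, hy, hyx⟩
    exact ⟨m, hm.1, hm.2, fun w hw hwx => hm' w ⟨hw, hwx⟩⟩
  have hexists : ∀ s : Setoid α, ∀ x, (∃ y < x, s y x) ↔ ¬ ∀ y, s x y → x ≤ y := fun s x => by
    push Not
    exact exists_congr fun y => ⟨fun h => ⟨s.symm h.2, h.1⟩, fun h => ⟨h.2, s.symm h.1⟩⟩
  have key : ∀ x, ∀ y < x, (p y x ↔ q y x) := by
    intro x
    induction x using WellFoundedLT.induction with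
    | ind x ih =>
      have hagree : ∀ a < x, ∀ b < x, (p a b ↔ q a b) := by
        intro a ha b hb
        rcases lt_trichotomy a b with h | rfl | h
        · exact ih b hb a h
        · exact iff_of_true (p.refl a) (q.refl a)
        · exact ⟨fun h' => q.symm ((ih a ha b h).1 (p.symm h')),
            fun h' => p.symm ((ih a ha b h).2 (q.symm h'))⟩
      by_cases hx : ∃ y < x, p y x
      · have hx' : ∃ y < x, q y x := by
          rw [hexists] at hx ⊢
          rwa [← hmin]
        obtain ⟨y, hyx, hpy, hy⟩ := hpred p x hx
        obtain ⟨z, hzx, hqz, hz⟩ := hpred q x hx'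
        obtain rfl : y = z := le_antisymm
          (predecessor_le_of_noncrossing hq (fun w => (hmax w).2) (hfin q)
            (fun a ha b hb => (hagree a ha b hb).2) hqz hz hyx hpy)
          (predecessor_le_of_noncrossing hp (fun w => (hmax w).1) (hfin p)
            (fun a ha b hb => (hagree a ha b hb).1) hpy hy hzx hqz)
        intro w hw
        exact ⟨fun h => q.trans ((hagree w hw y hyx).1 (p.trans h (p.symm hpy))) hqz,
          fun h => p.trans ((hagree w hw y hyx).2 (q.trans h (q.symm hqz))) hpy⟩
      · have hx' : ¬ ∃ y < x, q y x := by
          rw [hexists] at hx ⊢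
          rwa [← hmin]
        exact fun y hy => iff_of_false (fun h => hx ⟨y, hy, h⟩) (fun h => hx' ⟨y, hy, h⟩)
  ext a b
  rcases lt_trichotomy a b with h | rfl | h
  · exact key b a h
  · exact iff_of_true (p.refl a) (q.refl a)
  · exact ⟨fun h' => q.symm ((key a b h).1 (p.symm h')),
      fun h' => p.symm ((key a b h).2 (q.symm h'))⟩

end Noncrossing

section Evaluation

/-- Evaluation at the `0`/`1` matrix whose column `k` is supported on row `f k`. On polynomials
multilinear in the columns this extracts the coefficient of `∏ k, x_{f k, k}`. -/
noncomputable def evalWord {ν n : ℕ} (f : Fin n → Fin ν) :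
    MvPolynomial (Fin ν × Fin n) ℂ →+* ℂ :=
  MvPolynomial.eval fun p => if p.1 = f p.2 then 1 else 0

theorem evalWord_smul {ν n : ℕ} (f : Fin n → Fin ν) (a : ℂ)
    (p : MvPolynomial (Fin ν × Fin n) ℂ) : evalWord f (a • p) = a * evalWord f p :=
  MvPolynomial.smul_eval _ _ _

theorem evalWord_minor {ν n : ℕ} (f : Fin n → Fin ν) {I : Finset (Fin ν)} {J : Finset (Fin n)}
    (h : I.card = J.card) :
    evalWord f (minor ν n I J) = Matrix.det (Matrix.of fun a b : Fin I.card =>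
      if I.orderEmbOfFin rfl a = f (J.orderEmbOfFin h.symm b) then (1 : ℂ) else 0) := by
  rw [minor, dif_pos h, RingHom.map_det]
  congr 1
  ext a b
  simp [evalWord]

theorem image_eq_of_evalWord_minor_ne_zero {ν n : ℕ} {f : Fin n → Fin ν}
    {I : Finset (Fin ν)} {J : Finset (Fin n)} (h : evalWord f (minor ν n I J) ≠ 0) :
    J.image f = I := by
  have hcard : I.card = J.card := by
    by_contra hne
    simp [minor, hne] at h
  symm
  refine Finset.eq_of_subset_of_card_le (fun i hi => ?_) (hcard ▸ Finset.card_image_le)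
  obtain ⟨a, rfl⟩ : i ∈ Set.range (I.orderEmbOfFin rfl) := by simpa using hi
  by_contra hnot
  rw [evalWord_minor f hcard] at h
  refine h (Matrix.det_eq_zero_of_row_eq_zero a fun b => ?_)
  rw [Matrix.of_apply, if_neg]
  exact fun hab => hnot (hab ▸ Finset.mem_image_of_mem f (Finset.orderEmbOfFin_mem _ _ _))

theorem evalWord_minor_image_ne_zero {ν n : ℕ} {f : Fin n → Fin ν} {J : Finset (Fin n)}
    (hf : Set.InjOn f J) : evalWord f (minor ν n (J.image f) J) ≠ 0 := by
  have hcard : (J.image f).card = J.card := Finset.card_image_of_injOn hf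
  rw [evalWord_minor f hcard]
  have hmem : ∀ b, f (J.orderEmbOfFin hcard.symm b) ∈ J.image f := fun b =>
    Finset.mem_image_of_mem f (Finset.orderEmbOfFin_mem _ _ _)
  let e : Fin (J.image f).card → Fin (J.image f).card := fun b =>
    ((J.image f).orderIsoOfFin rfl).symm ⟨_, hmem b⟩
  have he : ∀ b, (J.image f).orderEmbOfFin rfl (e b) = f (J.orderEmbOfFin hcard.symm b) :=
    fun b => by simp [e, ← Finset.coe_orderIsoOfFin_apply]
  have hinj : Function.Injective e := fun b b' hb => by
    have h := (he b).symm.trans ((congrArg _ hb).trans (he b'))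
    exact (J.orderEmbOfFin hcard.symm).injective
      (hf (Finset.orderEmbOfFin_mem _ _ _) (Finset.orderEmbOfFin_mem _ _ _) h)
  let σ : Equiv.Perm (Fin (J.image f).card) :=
    Equiv.ofBijective e (Finite.injective_iff_bijective.1 hinj)
  have hσ : (Matrix.of fun a b : Fin (J.image f).card =>
      if (J.image f).orderEmbOfFin rfl a = f (J.orderEmbOfFin hcard.symm b)
        then (1 : ℂ) else 0) = (1 : Matrix _ _ ℂ).submatrix id σ := by
    ext a b
    simp only [Matrix.of_apply, Matrix.submatrix_apply, Matrix.one_apply, id]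
    rw [← he b]
    simp [σ]
  rw [hσ, Matrix.det_permute', Matrix.det_one, mul_one]
  rcases Int.units_eq_one_or (Equiv.Perm.sign σ) with h | h <;> simp [h]

end Evaluation

section Tableaux

variable {ν n d : ℕ}

theorem filterMap_eq_imp {α β : Type*} {g h : α → Option β} {l : List α}
    (hsome : ∀ i ∈ l, (g i).isSome = (h i).isSome) (heq : l.filterMap g = l.filterMap h) :
    ∀ i ∈ l, g i = h i := by
  induction l with
  | nil => simp
  | cons a l ih =>
    have ha := hsome a List.mem_cons_self
    have hl := fun i hi => hsome i (List.mem_cons_of_mem a hi)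
    rw [List.forall_mem_cons]
    cases hg : g a <;> cases hh : h a <;> simp [hg, hh] at ha heq ⊢
    · exact ih hl heq
    · exact ⟨heq.1, ih hl heq.2⟩

/-- A tableau is determined by its columns together with the rows each of them uses. -/
theorem tab_ext {T T' : Tab ν n d} (hcol : ∀ j, colList T j = colList T' j)
    (hrows : ∀ j, rowsUsed T j = rowsUsed T' j) : T = T' := by
  funext i j
  refine filterMap_eq_imp (fun i _ => ?_) (hcol j) i (List.mem_finRange i)
  rw [Bool.eq_iff_iff]
  simpa [rowsUsed] using Finset.ext_iff.1 (hrows j) i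

/-- There is a tableau with prescribed columns and prescribed rows used by each column. -/
theorem exists_tab (π : Fin d → Finset (Fin n)) (R : Fin d → Finset (Fin ν))
    (hcard : ∀ j, (R j).card = (π j).card) :
    ∃ T : Tab ν n d, (∀ j, colList T j = (π j).sort (· ≤ ·)) ∧ ∀ j, rowsUsed T j = R j := by
  let e : ∀ j, R j ≃o π j := fun j =>
    ((R j).orderIsoOfFin (hcard j)).symm.trans ((π j).orderIsoOfFin rfl)
  let T : Tab ν n d := fun i j => if h : i ∈ R j then some (e j ⟨i, h⟩ : Fin n) else none
  have hT : ∀ i j x, T i j = some x ↔ ∃ h : i ∈ R j, (e j ⟨i, h⟩ : Fin n) = x := by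
    intro i j x
    by_cases h : i ∈ R j <;> simp [T, h]
  refine ⟨T, fun j => ?_, fun j => ?_⟩
  · have hsorted : (colList T j).Pairwise (· < ·) := by
      refine List.Pairwise.filterMap _ (fun a a' haa b hb b' hb' => ?_)
        (List.pairwise_lt_finRange ν)
      obtain ⟨h, rfl⟩ := (hT _ _ _).1 hb
      obtain ⟨h', rfl⟩ := (hT _ _ _).1 hb'
      exact (e j).strictMono haa
    have hset : (colList T j).toFinset = π j := by
      ext x
      simp only [colList, List.mem_toFinset, List.mem_filterMap, List.mem_finRange, true_and, hT]
      constructor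
      · rintro ⟨i, h, rfl⟩
        exact (e j ⟨i, h⟩).2
      · intro hx
        exact ⟨(e j).symm ⟨x, hx⟩, ((e j).symm ⟨x, hx⟩).2, by simp⟩
    rw [← hset]
    exact ((List.toFinset_sort _ (hsorted.imp ne_of_lt)).2 (hsorted.imp le_of_lt)).symm
  · ext i
    by_cases h : i ∈ R j <;> simp [rowsUsed, T, h]

end Tableaux

section Jelly

variable {n d r : ℕ} {π : Fin d → Finset (Fin n)} {f : Fin n → Fin (n - (d - 1) * r)}

theorem evalWord_jellyInv : evalWord f (jellyInv n d r π) =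
    ∑ T : Tab (n - (d - 1) * r) n d, if IsJelly n d r π T then
      (tabSign T : ℂ) * ∏ j, evalWord f (minor _ n (rowsUsed T j) (π j)) else 0 := by
  rw [jellyInv, map_sum]
  refine Finset.sum_congr rfl fun T _ => ?_
  split_ifs
  · rw [evalWord_smul, JProd, map_prod]
  · exact map_zero _

theorem exists_isJelly_of_evalWord_ne_zero (h : evalWord f (jellyInv n d r π) ≠ 0) :
    ∃ T, IsJelly n d r π T ∧ ∀ j, (π j).image f = rowsUsed T j := by
  rw [evalWord_jellyInv] at h
  obtain ⟨T, -, hT⟩ := Finset.exists_ne_zero_of_sum_ne_zero h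
  rw [ne_eq, ite_eq_right_iff, Classical.not_imp] at hT
  exact ⟨T, hT.1, fun j => image_eq_of_evalWord_minor_ne_zero
    (Finset.prod_ne_zero_iff.1 (right_ne_zero_of_mul hT.2) j (Finset.mem_univ j))⟩

/-- A word with nonzero coefficient meets every one of the first `r` rows in every block. -/
theorem exists_mem_block_of_evalWord_ne_zero (h : evalWord f (jellyInv n d r π) ≠ 0)
    {i : Fin (n - (d - 1) * r)} (hi : (i : ℕ) < r) (j : Fin d) : ∃ x ∈ π j, f x = i := by
  obtain ⟨T, hT, hrows⟩ := exists_isJelly_of_evalWord_ne_zero h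
  rw [← Finset.mem_image, hrows j]
  simpa [rowsUsed] using hT.1 i hi j

theorem evalWord_jellyInv_ne_zero (hinj : ∀ j, Set.InjOn f (π j))
    (htop : ∀ i : Fin (n - (d - 1) * r), (i : ℕ) < r → ∀ j, i ∈ (π j).image f)
    (hlow : ∀ i : Fin (n - (d - 1) * r), r ≤ (i : ℕ) → ∃! j, i ∈ (π j).image f) :
    evalWord f (jellyInv n d r π) ≠ 0 := by
  obtain ⟨T, hcol, hrows⟩ := exists_tab π (fun j => (π j).image f)
    (fun j => Finset.card_image_of_injOn (hinj j))
  have hmem : ∀ i j, (T i j).isSome ↔ i ∈ (π j).image f := fun i j => by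
    rw [← hrows j]
    simp [rowsUsed]
  have hT : IsJelly n d r π T := by
    refine ⟨fun i hi j => (hmem i j).2 (htop i hi j), fun i hi => ?_, hcol⟩
    simpa only [hmem] using hlow i hi
  rw [evalWord_jellyInv, Finset.sum_eq_single T]
  · rw [if_pos hT]
    refine mul_ne_zero (by simp [tabSign]) (Finset.prod_ne_zero_iff.2 fun j _ => ?_)
    rw [hrows j]
    exact evalWord_minor_image_ne_zero (hinj j)
  · intro T' _ hne
    by_contra h
    rw [ite_eq_right_iff, Classical.not_imp] at h
    refine hne (tab_ext (fun j => (h.1.2.2 j).trans (hcol j).symm) fun j => ?_)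
    rw [hrows j, image_eq_of_evalWord_minor_ne_zero
      (Finset.prod_ne_zero_iff.1 (right_ne_zero_of_mul h.2) j (Finset.mem_univ j))]
  · exact fun h => absurd (Finset.mem_univ T) h

end Jelly

section Words

theorem exists_index {α : Type*} (s : Finset α) {a b : α} (ha : a ∈ s) (hb : b ∈ s)
    (hab : a ≠ b) : ∃ g : α → ℕ, Set.InjOn g s ∧ s.image g = Finset.range s.card ∧
      g a = 0 ∧ g b = 1 := by
  have hcard : 1 < s.card := Finset.one_lt_card.2 ⟨a, ha, b, hb, hab⟩
  obtain ⟨e, he⟩ := Finset.exists_equiv_extend_of_card_eq (α := s)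
    (t := Finset.range s.card) (by simp) (s := {⟨a, ha⟩, ⟨b, hb⟩})
    (f := fun x => if x.1 = a then 0 else 1)
    (by
      intro x hx
      obtain ⟨y, hy, rfl⟩ := Finset.mem_image.1 hx
      rw [Finset.mem_range]
      split_ifs <;> omega)
    (by
      intro x hx y hy hxy
      simp at hx hy
      rcases hx with rfl | rfl <;> rcases hy with rfl | rfl <;> simp [hab.symm] at hxy ⊢)
  have hval : ∀ x (hx : x ∈ s), (if h : x ∈ s then (e ⟨x, h⟩ : ℕ) else 0) = e ⟨x, hx⟩ :=
    fun x hx => dif_pos hx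
  refine ⟨fun x => if h : x ∈ s then (e ⟨x, h⟩ : ℕ) else 0, fun x hx y hy hxy => ?_, ?_, ?_, ?_⟩
  · simp only [hval x hx, hval y hy] at hxy
    exact congrArg Subtype.val (e.injective (Subtype.ext hxy))
  · ext k
    rw [Finset.mem_image]
    constructor
    · rintro ⟨x, hx, rfl⟩
      rw [hval x hx]
      exact (e ⟨x, hx⟩).2
    · intro hk
      exact ⟨e.symm ⟨k, hk⟩, (e.symm ⟨k, hk⟩).2, by simp⟩
  · refine (hval a ha).trans ?_
    rw [he _ (by simp)]
    simp
  · refine (hval b hb).trans ?_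
    rw [he _ (by simp)]
    simp [hab.symm]

/-- A word in which each of the first `r` letters occurs once in each block, each remaining
letter occurs exactly once, and `0` and `1` mark prescribed elements of each block. -/
theorem exists_word {n d r : ℕ} (hd : 0 < d) {π : Fin d → Finset (Fin n)} {c : Fin n → Fin d}
    (hc : ∀ x j, x ∈ π j ↔ c x = j) (hcard : ∀ j, r ≤ (π j).card) {lo hi : Fin d → Fin n}
    (hlo : ∀ j, c (lo j) = j) (hhi : ∀ j, c (hi j) = j) (hne : ∀ j, lo j ≠ hi j) (hr : 1 < r) :
    ∃ f : Fin n → Fin (n - (d - 1) * r), (∀ j, Set.InjOn f (π j)) ∧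
      (∀ i : Fin (n - (d - 1) * r), (i : ℕ) < r → ∀ j, i ∈ (π j).image f) ∧
      (∀ i : Fin (n - (d - 1) * r), r ≤ (i : ℕ) → ∃! j, i ∈ (π j).image f) ∧
      (∀ j, (f (lo j) : ℕ) = 0) ∧ ∀ j, (f (hi j) : ℕ) = 1 := by
  choose g hginj hgimg hglo hghi using fun j =>
    exists_index (π j) ((hc _ _).2 (hlo j)) ((hc _ _).2 (hhi j)) (hne j)
  let idx : Fin n → ℕ := fun x => g (c x) x
  have hidx : ∀ j x, x ∈ π j → idx x = g j x := fun j x hx => by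
    rw [← (hc x j).1 hx]
  have hsmall : (Finset.univ.filter fun x => idx x < r).card = d * r := by
    rw [Finset.card_eq_sum_card_fiberwise (f := c) (t := Finset.univ) (by simp)]
    rw [Finset.sum_const_nat (m := r), Finset.card_univ, Fintype.card_fin]
    intro j _
    rw [← Finset.card_image_of_injOn (f := g j) ((hginj j).mono ?_)]
    · convert Finset.card_range r
      ext k
      simp only [Finset.mem_image, Finset.mem_filter, Finset.mem_univ, true_and, Finset.mem_range]
      constructor
      · rintro ⟨x, ⟨hx, rfl⟩, rfl⟩
        exact hx
      · intro hk
        have : k ∈ (π j).image (g j) := by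
          rw [hgimg j, Finset.mem_range]
          exact hk.trans_le (hcard j)
        obtain ⟨x, hx, rfl⟩ := Finset.mem_image.1 this
        exact ⟨x, ⟨by rwa [hidx j x hx], (hc x j).1 hx⟩, rfl⟩
    · intro x hx
      simp only [Finset.coe_filter, Finset.mem_filter, Set.mem_ofPred_eq] at hx
      exact (hc x j).2 hx.2
  have hsum : d * r + Fintype.card {x // r ≤ idx x} = n := by
    rw [Fintype.card_subtype, ← hsmall]
    simpa using Finset.card_filter_add_card_filter_not (s := (Finset.univ : Finset (Fin n)))
      (fun x => idx x < r)
  have hν : n - (d - 1) * r = r + Fintype.card {x // r ≤ idx x} := by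
    obtain ⟨d, rfl⟩ := Nat.exists_eq_succ_of_ne_zero hd.ne'
    rw [Nat.succ_mul] at hsum
    rw [Nat.succ_sub_one]
    omega
  let φ := Fintype.equivFin {x // r ≤ idx x}
  let f : Fin n → Fin (n - (d - 1) * r) := fun x =>
    if h : r ≤ idx x then ⟨r + φ ⟨x, h⟩, by have := (φ ⟨x, h⟩).2; omega⟩
    else ⟨idx x, by omega⟩
  have hfsmall : ∀ x, idx x < r → (f x : ℕ) = idx x := fun x hx => by
    simp [f, hx.not_ge]
  have hflarge : ∀ x (h : r ≤ idx x), (f x : ℕ) = r + φ ⟨x, h⟩ := fun x hx => by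
    simp [f, hx]
  have hlarge_unique : ∀ x y, r ≤ (f x : ℕ) → f x = f y → x = y := by
    intro x y hx hxy
    have hidx_le : ∀ z, r ≤ (f z : ℕ) → r ≤ idx z := fun z hz => by
      by_contra! h
      rw [hfsmall z h] at hz
      omega
    have hy := hidx_le y (hxy ▸ hx)
    replace hx := hidx_le x hx
    have h := congrArg Fin.val hxy
    rw [hflarge x hx, hflarge y hy] at h
    exact congrArg Subtype.val (φ.injective (Fin.ext (Nat.add_left_cancel h)))
  refine ⟨f, fun j x hx y hy hxy => ?_, fun i hi j => ?_, fun i hi => ?_, fun j => ?_, fun j => ?_⟩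
  · by_cases h : r ≤ (f x : ℕ)
    · exact hlarge_unique x y h hxy
    · have hidx_eq : ∀ z, ¬ r ≤ (f z : ℕ) → (f z : ℕ) = idx z := fun z hz => by
        refine hfsmall z ?_
        by_contra! hz'
        rw [hflarge z hz'] at hz
        omega
      have h' := congrArg Fin.val hxy
      rw [hidx_eq x h, hidx_eq y (hxy ▸ h), hidx j x hx, hidx j y hy] at h'
      exact hginj j hx hy h'
  · have : (i : ℕ) ∈ (π j).image (g j) := by
      rw [hgimg j, Finset.mem_range]
      exact hi.trans_le (hcard j)
    obtain ⟨x, hx, hxi⟩ := Finset.mem_image.1 this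
    rw [← hidx j x hx] at hxi
    exact Finset.mem_image.2 ⟨x, hx, Fin.ext ((hfsmall x (hxi ▸ hi)).trans hxi)⟩
  · let k : Fin (Fintype.card {x // r ≤ idx x}) := ⟨i - r, by omega⟩
    have hk : f (φ.symm k) = i := by
      refine Fin.ext ?_
      rw [hflarge _ (φ.symm k).2]
      simp [k]
      omega
    refine ⟨c (φ.symm k), Finset.mem_image.2 ⟨_, (hc _ _).2 rfl, hk⟩, fun j hj => ?_⟩
    obtain ⟨y, hy, hyi⟩ := Finset.mem_image.1 hj
    rw [← hlarge_unique y (φ.symm k) (hyi ▸ hi) (hyi.trans hk.symm)]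
    exact ((hc y j).1 hy).symm
  · have h : idx (lo j) = 0 := by simp [idx, hlo, hglo]
    rw [hfsmall _ (by omega), h]
  · have h : idx (hi j) = 1 := by simp [idx, hhi, hghi]
    rw [hfsmall _ (by omega), h]

end Words

section Blocks

variable {n d r : ℕ}

/-- `c` records the block containing each element of an ordered set partition, and `lo`, `hi`
the smallest and largest element of each block. -/
structure BlockData (π : Fin d → Finset (Fin n)) (c : Fin n → Fin d)
    (lo hi : Fin d → Fin n) : Prop where
  mem_iff : ∀ x j, x ∈ π j ↔ c x = j
  block_lo : ∀ j, c (lo j) = j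
  block_hi : ∀ j, c (hi j) = j
  lo_le : ∀ x, lo (c x) ≤ x
  le_hi : ∀ x, x ≤ hi (c x)

theorem IsOSP.exists_blockData {π : Fin d → Finset (Fin n)} (h : IsOSP n d r π) (hr : 0 < r) :
    ∃ c lo hi, BlockData π c lo hi := by
  have hex : ∀ x, ∃ j, x ∈ π j := fun x => by
    have : x ∈ Finset.univ.biUnion π := h.2.2 ▸ Finset.mem_univ x
    simpa using this
  choose c hcm using hex
  have hne : ∀ j, (π j).Nonempty := fun j => Finset.card_pos.1 (hr.trans_le (h.1 j))
  have hc : ∀ x j, x ∈ π j ↔ c x = j := by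
    refine fun x j => ⟨fun hx => ?_, fun hx => hx ▸ hcm x⟩
    by_contra hcj
    exact Finset.disjoint_left.1 (h.2.1 _ _ hcj) (hcm x) hx
  exact ⟨c, fun j => (π j).min' (hne j), fun j => (π j).max' (hne j), hc,
    fun j => (hc _ _).1 (Finset.min'_mem _ _), fun j => (hc _ _).1 (Finset.max'_mem _ _),
    fun x => Finset.min'_le _ _ (hcm x), fun x => Finset.le_max' _ _ (hcm x)⟩

namespace BlockData

variable {π π' : Fin d → Finset (Fin n)} {c c' : Fin n → Fin d} {lo lo' hi hi' : Fin d → Fin n}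

theorem lo_ne_hi (h : BlockData π c lo hi) {j : Fin d} (hj : 1 < (π j).card) : lo j ≠ hi j := by
  intro heq
  obtain ⟨x, hx, y, hy, hxy⟩ := Finset.one_lt_card.1 hj
  have key : ∀ z ∈ π j, z = lo j := fun z hz => by
    obtain rfl := (h.mem_iff z j).1 hz
    exact le_antisymm (heq ▸ h.le_hi z) (h.lo_le z)
  exact hxy ((key x hx).trans (key y hy).symm)

theorem isMin_iff (h : BlockData π c lo hi) (x : Fin n) :
    (∀ y, c x = c y → x ≤ y) ↔ x ∈ Set.range lo := by
  constructor
  · exact fun hx => ⟨c x, le_antisymm (h.lo_le x) (hx _ (h.block_lo _).symm)⟩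
  · rintro ⟨j, rfl⟩ y hy
    rw [h.block_lo] at hy
    exact hy ▸ h.lo_le y

theorem isMax_iff (h : BlockData π c lo hi) (x : Fin n) :
    (∀ y, c x = c y → y ≤ x) ↔ x ∈ Set.range hi := by
  constructor
  · exact fun hx => ⟨c x, le_antisymm (hx _ (h.block_hi _).symm) (h.le_hi x)⟩
  · rintro ⟨j, rfl⟩ y hy
    rw [h.block_hi] at hy
    exact hy ▸ h.le_hi y

theorem noncrossing (h : BlockData π c lo hi) (hnc : IsNoncrossing n (Finset.univ.image π))
    (a b x e : Fin n) (hab : a < b) (hbx : b < x) (hxe : x < e) (hax : c a = c x)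
    (hbe : c b = c e) : c a = c b := by
  have hmem : ∀ j, π j ∈ Finset.univ.image π := fun j =>
    Finset.mem_image_of_mem π (Finset.mem_univ j)
  have heq := hnc a b x e hab hbx hxe _ (hmem (c a)) _ (hmem (c b)) ((h.mem_iff _ _).2 rfl)
    ((h.mem_iff _ _).2 hax.symm) ((h.mem_iff _ _).2 rfl) ((h.mem_iff _ _).2 hbe.symm)
  exact (h.mem_iff a (c b)).1 (heq ▸ (h.mem_iff a (c a)).2 rfl)

theorem image_subset (h : BlockData π c lo hi) (h' : BlockData π' c' lo' hi')
    (hker : Setoid.ker c = Setoid.ker c') : Finset.univ.image π ⊆ Finset.univ.image π' := by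
  intro B hB
  obtain ⟨j, -, rfl⟩ := Finset.mem_image.1 hB
  refine Finset.mem_image.2 ⟨c' (lo j), Finset.mem_univ _, ?_⟩
  ext x
  rw [h.mem_iff, h'.mem_iff]
  have hx : c x = c (lo j) ↔ c' x = c' (lo j) := by
    simpa only [Setoid.ker_def] using Setoid.ext_iff.1 hker x (lo j)
  rw [← hx, h.block_lo]

theorem image_eq (h : BlockData π c lo hi) (h' : BlockData π' c' lo' hi')
    (hnc : IsNoncrossing n (Finset.univ.image π)) (hnc' : IsNoncrossing n (Finset.univ.image π'))
    (hlo : Set.range lo = Set.range lo') (hhi : Set.range hi = Set.range hi') :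
    Finset.univ.image π = Finset.univ.image π' := by
  have hker : Setoid.ker c = Setoid.ker c' := by
    refine noncrossing_setoid_ext ?_ ?_ ?_ ?_ <;> simp only [Setoid.ker_def]
    · exact h.noncrossing hnc
    · exact h'.noncrossing hnc'
    · exact fun x => by rw [h.isMin_iff, h'.isMin_iff, hlo]
    · exact fun x => by rw [h.isMax_iff, h'.isMax_iff, hhi]
  exact (h.image_subset h' hker).antisymm (h'.image_subset h hker.symm)

/-- If the marked points `p j` form a transversal for the second partition, choosing the marked
point in each of its blocks defines a permutation of the blocks. -/
theorem exists_perm_of_transversal (h' : BlockData π' c' lo' hi') (p : Fin d → Fin n)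
    (hp : ∀ j, ∃ x ∈ π' j, x ∈ Set.range p) :
    ∃ σ : Equiv.Perm (Fin d), ∀ j, c' (p (σ j)) = j := by
  choose x hx σ hσ using hp
  have hcσ : ∀ j, c' (p (σ j)) = j := fun j => by rw [hσ, (h'.mem_iff _ _).1 (hx j)]
  exact ⟨Equiv.ofBijective σ (Finite.injective_iff_bijective.1
    (Function.LeftInverse.injective (g := fun k => c' (p k)) hcσ)), hcσ⟩

/-- If the block minima and the block maxima of the first partition are both transversals of the
second, then the second has the larger total block width, with equality only if the two
partitions have the same block minima and maxima. -/
theorem range_eq_of_width_le (h' : BlockData π' c' lo' hi')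
    (hlo : ∀ j, ∃ x ∈ π' j, x ∈ Set.range lo) (hhi : ∀ j, ∃ x ∈ π' j, x ∈ Set.range hi)
    (hle : ∑ j, ((hi' j : ℤ) - (lo' j : ℤ)) ≤ ∑ j, ((hi j : ℤ) - (lo j : ℤ))) :
    Set.range lo' = Set.range lo ∧ Set.range hi' = Set.range hi := by
  obtain ⟨σ, hσ⟩ := h'.exists_perm_of_transversal lo hlo
  obtain ⟨τ, hτ⟩ := h'.exists_perm_of_transversal hi hhi
  have h1 : ∀ j, lo' j ≤ lo (σ j) := fun j => by simpa [hσ j] using h'.lo_le (lo (σ j))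
  have h2 : ∀ j, hi (τ j) ≤ hi' j := fun j => by simpa [hτ j] using h'.le_hi (hi (τ j))
  have hterm : ∀ j ∈ Finset.univ, ((hi (τ j) : ℤ) - (lo (σ j) : ℤ)) ≤ (hi' j : ℤ) - (lo' j : ℤ) :=
    fun j _ => by
      have a := Fin.le_def.1 (h1 j)
      have b := Fin.le_def.1 (h2 j)
      omega
  have hsum : ∑ j, ((hi (τ j) : ℤ) - (lo (σ j) : ℤ)) = ∑ j, ((hi j : ℤ) - (lo j : ℤ)) := by
    rw [Finset.sum_sub_distrib, Finset.sum_sub_distrib,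
      Equiv.sum_comp τ (fun j => (hi j : ℤ)), Equiv.sum_comp σ (fun j => (lo j : ℤ))]
  have heq := (Finset.sum_eq_sum_iff_of_le hterm).1
    (le_antisymm (Finset.sum_le_sum hterm) (hle.trans_eq hsum.symm))
  have hboth : ∀ j, lo' j = lo (σ j) ∧ hi' j = hi (τ j) := fun j => by
    have a := Fin.le_def.1 (h1 j)
    have b := Fin.le_def.1 (h2 j)
    have e := heq j (Finset.mem_univ j)
    exact ⟨Fin.ext (by omega), Fin.ext (by omega)⟩
  constructor
  · rw [show lo' = lo ∘ σ from funext fun j => (hboth j).1, σ.surjective.range_comp]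
  · rw [show hi' = hi ∘ τ from funext fun j => (hboth j).2, τ.surjective.range_comp]

end BlockData

end Blocks

/-- for `r > 1`, choosing for each noncrossing set partition
`γ ∈ NC(n,d,r)` an arbitrary ordering `π γ` of its blocks, the family of jellyfish
invariants `[π_γ]_r` is linearly independent over `ℂ`. -/
theorem statement9 (n d r : ℕ) (hn : 0 < n) (hd : 0 < d) (hr : 1 < r)
    (π : Finset (Finset (Fin n)) → (Fin d → Finset (Fin n)))
    (hπ : ∀ γ, IsNCPartition n d r γ →
      IsOSP n d r (π γ) ∧ Finset.univ.image (π γ) = γ) :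
    LinearIndependent ℂ
      (fun γ : {γ : Finset (Finset (Fin n)) // IsNCPartition n d r γ} =>
        jellyInv n d r (π γ)) := by
  choose c lo hi hB using fun γ : {γ : Finset (Finset (Fin n)) // IsNCPartition n d r γ} =>
    (hπ γ γ.2).1.exists_blockData (zero_lt_one.trans hr)
  choose f hinj htop hlow hflo hfhi using fun γ =>
    exists_word hd (hB γ).mem_iff (hπ γ.1 γ.2).1.1 (hB γ).block_lo (hB γ).block_hi
      (fun j => (hB γ).lo_ne_hi (hr.trans_le ((hπ γ.1 γ.2).1.1 j))) hr
  refine linearIndependent_of_triangular _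
    (fun γ => (MvPolynomial.aeval fun p => if p.1 = f γ p.2 then (1 : ℂ) else 0).toLinearMap)
    (fun γ => ∑ j, ((hi γ j : ℤ) - (lo γ j : ℤ))) (fun γ => ?_) (fun γ δ hne hle => ?_)
  · exact evalWord_jellyInv_ne_zero (hinj γ) (htop γ) (hlow γ)
  · have hne' : evalWord (f γ) (jellyInv n d r (π δ)) ≠ 0 := hne
    have hlift : ∀ p : Fin d → Fin n, ∀ k < r, (∀ j, c γ (p j) = j) →
        (∀ j, (f γ (p j) : ℕ) = k) → ∀ j, ∃ x ∈ π δ j, x ∈ Set.range p := by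
      intro p k hk hcp hp j
      obtain ⟨x, hx, hfx⟩ := exists_mem_block_of_evalWord_ne_zero hne'
        (i := f γ (p j)) ((hp j).trans_lt hk) j
      refine ⟨x, hx, c γ x, ?_⟩
      refine hinj γ (c γ x) (((hB γ).mem_iff _ _).2 (hcp _)) (((hB γ).mem_iff _ _).2 rfl) ?_
      rw [hfx]
      exact Fin.ext ((hp _).trans (hp j).symm)
    obtain ⟨hrlo, hrhi⟩ := (hB δ).range_eq_of_width_le
      (hlift (lo γ) 0 (by omega) (hB γ).block_lo (hflo γ))
      (hlift (hi γ) 1 hr (hB γ).block_hi (hfhi γ)) hle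
    have himg := (hB δ).image_eq (hB γ) (by rw [(hπ δ.1 δ.2).2]; exact δ.2.2.1)
      (by rw [(hπ γ.1 γ.2).2]; exact γ.2.2.1) hrlo hrhi
    rw [(hπ δ.1 δ.2).2, (hπ γ.1 γ.2).2] at himg
    exact Subtype.ext himg

end Jellyfish
end
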